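/- arXiv:1610.06990 — 2 statements merged into one kernel-verified Lean document; each statement's English description precedes it below -/
import Mathlib

section
/- For any ℤ[x]-lattice L ⊆ ℤ[x]^n, the radical well-mixed closure ⟨I_L⟩_r of the lattice σ-ideal I_L in K{y_1,…,y_n} is finitely generated as a radical well-mixed σ-ideal; that is, there exists a finite set G of pure binomials in ⟨I_L⟩_r with ⟨I_L⟩_r = ⟨G⟩_r. -/
open Polynomial

section SigmaRing

variable {R : Type*} [CommRing R]

/-- A σ-ideal: an ideal closed under the difference operator σ. -/
def IsSigmaIdeal (σ : R →+* R) (I : Ideal R) : Prop := ∀ a ∈ I, σ a ∈ I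

/-- A σ-ideal is well-mixed if `a * b ∈ I` implies `a * σ b ∈ I`. -/
def IsWellMixed (σ : R →+* R) (I : Ideal R) : Prop := ∀ a b : R, a * b ∈ I → a * σ b ∈ I

/-- `[F]`, the smallest σ-ideal containing `F`. -/
def sigmaIdealGen (σ : R →+* R) (F : Set R) : Ideal R :=
  sInf {I : Ideal R | F ⊆ I ∧ IsSigmaIdeal σ I}

/-- `⟨F⟩`, the smallest well-mixed σ-ideal containing `F` (well-mixed closure). -/
def wmClosure (σ : R →+* R) (F : Set R) : Ideal R :=
  sInf {I : Ideal R | F ⊆ I ∧ IsSigmaIdeal σ I ∧ IsWellMixed σ I}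

/-- `⟨F⟩_r`, the smallest radical well-mixed σ-ideal containing `F`. -/
def rwmClosure (σ : R →+* R) (F : Set R) : Ideal R :=
  sInf {I : Ideal R | F ⊆ I ∧ IsSigmaIdeal σ I ∧ IsWellMixed σ I ∧ I.IsRadical}

/-- Symbolic exponent: for `p = Σ c_i x^i ∈ ℕ[x]`, `a^p = Π (σ^i a)^(c_i)`. -/
noncomputable def sexp (σ : R →+* R) (a : R) (p : Polynomial ℕ) : R :=
  ∏ i ∈ Finset.range (p.natDegree + 1), ((⇑σ)^[i] a) ^ (p.coeff i)

/-- `I` is finitely generated as a radical well-mixed σ-ideal. -/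
def FinGenAsRWM (σ : R →+* R) (I : Ideal R) : Prop :=
  ∃ G : Set R, G.Finite ∧ G ⊆ (I : Set R) ∧ I = rwmClosure σ G

/-- σ-prime: a reflexive σ-ideal which is prime. -/
def IsSigmaPrime (σ : R →+* R) (I : Ideal R) : Prop :=
  IsSigmaIdeal σ I ∧ (∀ a : R, σ a ∈ I → a ∈ I) ∧ I.IsPrime

end SigmaRing

/-- The σ-polynomial ring `K{y_1,…,y_n}`: polynomials in variables `y_i^{x^j}`,
indexed by pairs `(i, j) ∈ Fin n × ℕ`. -/
abbrev DPoly (K : Type*) [Field K] (n : ℕ) := MvPolynomial (Fin n × ℕ) K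

section DPoly

variable {K : Type*} [Field K] {n : ℕ} (σK : K →+* K)

/-- The difference operator on `K{y_1,…,y_n}` extending `σK`, with `σ(y_i^{x^j}) = y_i^{x^{j+1}}`. -/
noncomputable def shift : DPoly K n →+* DPoly K n :=
  MvPolynomial.eval₂Hom ((MvPolynomial.C : K →+* DPoly K n).comp σK)
    (fun v => MvPolynomial.X (v.1, v.2 + 1))

/-- `y_i^p` for `p ∈ ℕ[x]`. -/
noncomputable def ypow (i : Fin n) (p : Polynomial ℕ) : DPoly K n :=
  sexp (shift σK) (MvPolynomial.X (i, 0)) p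

/-- `y_i^{x^a}`. -/
noncomputable def varPow (i : Fin n) (a : ℕ) : DPoly K n :=
  ypow σK i (Polynomial.X ^ a)

/-- The monomial `Y^f = Π y_i^{f_i}` for `f ∈ ℕ[x]^n`. -/
noncomputable def monom (f : Fin n → Polynomial ℕ) : DPoly K n :=
  ∏ i, ypow σK i (f i)

/-- A pure binomial `Y^f − Y^g`. -/
def IsPureBinomial (p : DPoly K n) : Prop :=
  ∃ f g : Fin n → Polynomial ℕ, p = monom σK f - monom σK g

/-- A binomial `a·Y^f + b·Y^g` with `a, b ∈ K^×`. -/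
def IsBinomial (p : DPoly K n) : Prop :=
  ∃ (a b : K) (f g : Fin n → Polynomial ℕ), a ≠ 0 ∧ b ≠ 0 ∧
    p = MvPolynomial.C a * monom σK f + MvPolynomial.C b * monom σK g

/-- A pure binomial σ-ideal: a σ-ideal generated by pure binomials. -/
def IsPureBinomialSigmaIdeal (I : Ideal (DPoly K n)) : Prop :=
  ∃ S : Set (DPoly K n), (∀ p ∈ S, IsPureBinomial σK p) ∧ I = sigmaIdealGen (shift σK) S

/-- Positive part of `f ∈ ℤ[x]`. -/
noncomputable def posPart (f : Polynomial ℤ) : Polynomial ℕ :=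
  f.sum fun i c => Polynomial.monomial i c.toNat

/-- Negative part of `f ∈ ℤ[x]`. -/
noncomputable def negPart (f : Polynomial ℤ) : Polynomial ℕ :=
  f.sum fun i c => Polynomial.monomial i (-c).toNat

/-- The lattice σ-ideal `I_L = [Y^{f_+} − Y^{f_−} : f ∈ L]` of a ℤ[x]-lattice `L ⊆ ℤ[x]^n`. -/
noncomputable def latticeIdeal (L : Submodule (Polynomial ℤ) (Fin n → Polynomial ℤ)) :
    Ideal (DPoly K n) :=
  sigmaIdealGen (shift σK)
    {p | ∃ f ∈ L, p = monom σK (fun i => posPart (f i)) - monom σK (fun i => negPart (f i))}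

end DPoly

/-- `𝔪`: the multiplicatively closed set generated by the variables `y_i^{x^j}`. -/
def mSet (K : Type*) [Field K] (n : ℕ) : Set (DPoly K n) :=
  (Submonoid.closure (Set.range fun v : Fin n × ℕ => (MvPolynomial.X v : DPoly K n)) : Set _)

/-- `I : 𝔪 = {p : M p ∈ I for some M ∈ 𝔪}`. -/
def colonM {K : Type*} [Field K] {n : ℕ} (I : Ideal (DPoly K n)) : Set (DPoly K n) :=
  {p | ∃ M ∈ mSet K n, M * p ∈ I}

section Tsec

variable {K : Type*} [Field K] {n t : ℕ} (σK : K →+* K)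

/-- The set `T^{a_1…a_t}_{j_1…j_t}` of monomials `Y^f` with `deg f_{j_i} < a_i`. -/
def Tset (j : Fin t → Fin n) (a : Fin t → ℕ) : Set (DPoly K n) :=
  {p | ∃ f : Fin n → Polynomial ℕ,
    (∀ i : Fin t, (f (j i)).degree < (a i : WithBot ℕ)) ∧ p = monom σK f}

/-- `I` is saturated with respect to `{y_{j_1}^{x^{a_1}},…,y_{j_t}^{x^{a_t}}}`. -/
def SaturatedWrt (j : Fin t → Fin n) (a : Fin t → ℕ) (I : Ideal (DPoly K n)) : Prop :=
  ∀ g M : DPoly K n, M ∈ Tset σK j a → M * g ∈ I → g ∈ I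

/-- `J : T = {g : M g ∈ J for some M ∈ T}`. -/
def colonT (j : Fin t → Fin n) (a : Fin t → ℕ) (J : Ideal (DPoly K n)) : Set (DPoly K n) :=
  {g | ∃ M ∈ Tset σK j a, M * g ∈ J}

/-- The `T`-saturated closure `N^{a_1…a_t}_{j_1…j_t}(I)`: the smallest saturated σ-ideal
containing `I`. -/
noncomputable def Nclosure (j : Fin t → Fin n) (a : Fin t → ℕ) (I : Ideal (DPoly K n)) :
    Ideal (DPoly K n) :=
  sInf {J : Ideal (DPoly K n) | I ≤ J ∧ IsSigmaIdeal (shift σK) J ∧ SaturatedWrt σK j a J}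

/-- The set of variables `{y_{j_1}^{x^{a_1}},…,y_{j_t}^{x^{a_t}}}`. -/
noncomputable def varSet (j : Fin t → Fin n) (a : Fin t → ℕ) : Set (DPoly K n) :=
  Set.range fun i => varPow σK (j i) (a i)

/-- `⟨I₀ ∪ {y_{j_1}^{x^{a_1}},…,y_{j_t}^{x^{a_t}}}⟩_r` is quasi-normal. -/
def QuasiNormal (j : Fin t → Fin n) (a : Fin t → ℕ) (I0 : Ideal (DPoly K n)) : Prop :=
  SaturatedWrt σK j a I0 ∧
  ∀ f g : Fin n → Polynomial ℕ, monom σK f - monom σK g ∈ I0 →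
    monom σK f ∈ sigmaIdealGen (shift σK) (varSet σK j a) →
    monom σK g ∈ sigmaIdealGen (shift σK) (varSet σK j a)

end Tsec

/-- A well-quasi-order admits a finite basis below any predicate. -/
theorem WellQuasiOrdered.exists_finset_basis {α : Type*} {r : α → α → Prop}
    (hr : WellQuasiOrdered r) (P : α → Prop) :
    ∃ F : Finset α, (∀ x ∈ F, P x) ∧ ∀ y, P y → ∃ x ∈ F, r x y := by
  by_contra! h
  obtain ⟨u, -, hu⟩ := exists_seq_of_forall_finset_exists P (fun x y => ¬ r x y) h
  obtain ⟨m, k, hmk, hrel⟩ := hr u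
  exact hu m k hmk hrel

/-- A monotone map from a well-quasi-order to a Noetherian lattice of ideals takes the same value
at two comparable terms of any sequence. -/
theorem wellQuasiOrdered_le_and_eq {α R : Type*} [Preorder α] [WellQuasiOrderedLE α] [CommRing R]
    [IsNoetherianRing R] {φ : α → Ideal R} (hφ : Monotone φ) :
    WellQuasiOrdered fun p q => p ≤ q ∧ φ p = φ q := by
  intro u
  obtain ⟨g, hg⟩ := wellQuasiOrdered_le.exists_monotone_subseq u
  obtain ⟨N, hN⟩ := monotone_stabilizes_iff_noetherian.mpr ‹IsNoetherianRing R›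
    ⟨fun m => φ (u (g m)), fun a b hab => hφ (hg a b hab)⟩
  exact ⟨g N, g (N + 1), g.strictMono N.lt_succ_self, hg _ _ N.le_succ, hN _ N.le_succ⟩

section Lattice

variable {n : ℕ}

/-- The components of `f` have degree less than the prescribed bounds. -/
def DegreesBelow (a : Fin n → ℕ) (f : Fin n → ℤ[X]) : Prop :=
  ∀ i j, a i ≤ j → (f i).coeff j = 0

/-- The coefficients of `f` at or above the prescribed bounds are nonnegative, and one of them,
in the component `v`, is positive. -/
def PositiveAbove (a : Fin n → ℕ) (f : Fin n → ℤ[X]) (v : Fin n) : Prop :=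
  (∀ i j, a i ≤ j → 0 ≤ (f i).coeff j) ∧ ∃ j, a v ≤ j ∧ 0 < (f v).coeff j

theorem coeff_X_pow_smul (f : Fin n → ℤ[X]) (e : ℕ) (i : Fin n) (j : ℕ) :
    ((((X : ℤ[X]) ^ e) • f) i).coeff j = if e ≤ j then (f i).coeff (j - e) else 0 := by
  simp [coeff_X_pow_mul']

/-- The ideal of leading coefficients, at degree `p.1` in the component `k`, of the elements of `L`
which vanish on `T` and whose degrees are less than `p.1 + p.2`. -/
def leadIdeal (L : Submodule ℤ[X] (Fin n → ℤ[X])) (T : Finset (Fin n)) (k : Fin n)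
    (p : ℕ × (Fin n → ℕ)) : Ideal ℤ where
  carrier := {c | ∃ f ∈ L, (∀ i ∈ T, f i = 0) ∧ DegreesBelow (fun i => p.1 + p.2 i) f ∧
    (∀ j, p.1 < j → (f k).coeff j = 0) ∧ (f k).coeff p.1 = c}
  zero_mem' := ⟨0, L.zero_mem, by simp, fun i j _ => by simp, by simp, by simp⟩
  add_mem' := by
    rintro _ _ ⟨f, hf, hT, hb, hd, rfl⟩ ⟨g, hg, hT', hb', hd', rfl⟩
    refine ⟨f + g, L.add_mem hf hg, fun i hi => by simp [hT i hi, hT' i hi],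
      fun i j hij => by simp [hb i j hij, hb' i j hij],
      fun j hj => by simp [hd j hj, hd' j hj], by simp⟩
  smul_mem' := by
    rintro c _ ⟨f, hf, hT, hb, hd, rfl⟩
    refine ⟨c • f, zsmul_mem hf c, fun i hi => by simp [hT i hi],
      fun i j hij => by simp [hb i j hij], fun j hj => by simp [hd j hj], by simp⟩

theorem leadIdeal_mono (L : Submodule ℤ[X] (Fin n → ℤ[X])) (T : Finset (Fin n)) (k : Fin n) :
    Monotone (leadIdeal L T k) := by
  rintro ⟨d, h⟩ ⟨d', h'⟩ ⟨hd, hh⟩ _ ⟨f, hf, hT, hb, hdeg, rfl⟩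
  simp only at hd hh hb hdeg
  refine ⟨(X : ℤ[X]) ^ (d' - d) • f, L.smul_mem _ hf, fun i hi => by simp [hT i hi], ?_, ?_, ?_⟩
  · intro i j hij
    have hi : h i ≤ h' i := hh i
    simp only at hij
    rw [coeff_X_pow_smul]
    split_ifs
    · exact hb i _ (by dsimp only; omega)
    · rfl
  · intro j hj
    simp only at hj
    rw [coeff_X_pow_smul]
    split_ifs
    · exact hdeg _ (by omega)
    · rfl
  · rw [coeff_X_pow_smul, if_pos (by dsimp only; omega)]
    congr 1
    dsimp only
    omega

theorem exists_leadIdeal_generator (L : Submodule ℤ[X] (Fin n → ℤ[X])) (T : Finset (Fin n))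
    (k : Fin n) (p : ℕ × (Fin n → ℕ)) :
    ∃ g ∈ L, (∀ i ∈ T, g i = 0) ∧ DegreesBelow (fun i => p.1 + p.2 i) g ∧
      (∀ j, p.1 < j → (g k).coeff j = 0) ∧
      ∀ c ∈ leadIdeal L T k p, ∃ m : ℤ, c = m * (g k).coeff p.1 := by
  obtain ⟨g, hg, hT, hb, hd, hc⟩ := Submodule.IsPrincipal.generator_mem (leadIdeal L T k p)
  refine ⟨g, hg, hT, hb, hd, fun c h => ?_⟩
  obtain ⟨m, hm⟩ := (Submodule.IsPrincipal.mem_iff_eq_smul_generator _).mp h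
  exact ⟨m, by rw [hc, hm, smul_eq_mul]⟩

/-- A `ℤ[x]`-lattice has a finite set of generators compatible with all multidegree bounds. -/
theorem exists_finite_degree_compatible_generators (L : Submodule ℤ[X] (Fin n → ℤ[X])) :
    ∃ S : Set (Fin n → ℤ[X]), S.Finite ∧ S ⊆ L ∧ ∀ b : Fin n → ℕ, ∀ f ∈ L, DegreesBelow b f →
      f ∈ AddSubgroup.closure
        {g | ∃ s ∈ S, ∃ e : ℕ, g = (X : ℤ[X]) ^ e • s ∧ DegreesBelow b g} := by
  choose g hgL hgT hgb hgd hgc using exists_leadIdeal_generator L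
  choose F _ hF using fun T k => (wellQuasiOrdered_le_and_eq (leadIdeal_mono L T k)).exists_finset_basis
    (fun _ => True)
  refine ⟨⋃ T, ⋃ k, g T k '' F T k, Set.finite_iUnion fun T => Set.finite_iUnion fun k =>
    (F T k).finite_toSet.image _, ?_, fun b => ?_⟩
  · simp only [Set.iUnion_subset_iff, Set.image_subset_iff]
    exact fun T k q _ => hgL T k q
  set S := ⋃ T, ⋃ k, g T k '' F T k with hS
  suffices H : ∀ m : ℕ, ∀ T : Finset (Fin n), Tᶜ.card = m → ∀ f ∈ L, (∀ i ∈ T, f i = 0) →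
      DegreesBelow b f → f ∈ AddSubgroup.closure
        {g | ∃ s ∈ S, ∃ e : ℕ, g = (X : ℤ[X]) ^ e • s ∧ DegreesBelow b g} from
    fun f hf hb => H _ ∅ rfl f hf (by simp) hb
  intro m
  induction m with
  | zero =>
    intro T hT f _ hfT _
    rw [Finset.card_eq_zero, Finset.compl_eq_empty_iff] at hT
    have : f = 0 := funext fun i => hfT i (by simp [hT])
    rw [this]
    exact zero_mem _
  | succ m ih =>
    intro T hT
    obtain ⟨k, hk, hmin⟩ := Finset.exists_min_image Tᶜ b (Finset.card_pos.mp (by omega))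
    suffices H : ∀ d : ℕ, ∀ f ∈ L, (∀ i ∈ T, f i = 0) → DegreesBelow b f →
        (∀ j, d ≤ j → (f k).coeff j = 0) → f ∈ AddSubgroup.closure
          {g | ∃ s ∈ S, ∃ e : ℕ, g = (X : ℤ[X]) ^ e • s ∧ DegreesBelow b g} from
      fun f hf hfT hb => H (b k) f hf hfT hb (hb k)
    intro d
    induction d with
    | zero =>
      intro f hf hfT hb hd
      refine ih (insert k T) ?_ f hf ?_ hb
      · rw [Finset.compl_insert, Finset.card_erase_of_mem hk, hT]
        rfl
      · rintro i hi
        rcases Finset.mem_insert.mp hi with rfl | hi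
        · ext j
          simpa using hd j (Nat.zero_le _)
        · exact hfT i hi
    | succ d ihd =>
      intro f hf hfT hb hd
      rcases Nat.lt_or_ge d (b k) with hdk | hdk
      swap
      · refine ihd f hf hfT hb fun j hj => hb k j (hdk.trans hj)
      have hmem : (f k).coeff d ∈ leadIdeal L T k (d, fun i => b i - d) := by
        refine ⟨f, hf, hfT, fun i j hij => ?_, fun j hj => hd j hj, rfl⟩
        by_cases hi : i ∈ T
        · simp [hfT i hi]
        · have := hmin i (Finset.mem_compl.mpr hi)
          exact hb i j (by simp only at hij; omega)
      obtain ⟨q, hqF, ⟨hq1, hq2⟩, hqe⟩ := hF T k (d, fun i => b i - d) trivial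
      simp only at hq1 hq2
      rw [← hqe] at hmem
      obtain ⟨c, hc⟩ := hgc T k q _ hmem
      set s := g T k q with hs
      have hgen : DegreesBelow b ((X : ℤ[X]) ^ (d - q.1) • s) := by
        intro i j hij
        by_cases hi : i ∈ T
        · simp [hs, hgT T k q i hi]
        have h1 := hmin i (Finset.mem_compl.mpr hi)
        have h2 : q.2 i ≤ b i - d := hq2 i
        rw [coeff_X_pow_smul]
        split_ifs
        · exact hgb T k q i _ (by dsimp only; omega)
        · rfl
      have hgen' : c • ((X : ℤ[X]) ^ (d - q.1) • s) ∈ AddSubgroup.closure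
          {g | ∃ s ∈ S, ∃ e : ℕ, g = (X : ℤ[X]) ^ e • s ∧ DegreesBelow b g} := by
        refine zsmul_mem ?_ c
        refine AddSubgroup.subset_closure ⟨s, ?_, _, rfl, hgen⟩
        simp only [hS, Set.mem_iUnion]
        exact ⟨T, k, q, hqF, rfl⟩
      rw [← sub_add_cancel f (c • ((X : ℤ[X]) ^ (d - q.1) • s))]
      refine add_mem (ihd _ ?_ ?_ ?_ ?_) hgen'
      · exact L.sub_mem hf (zsmul_mem (L.smul_mem _ (hgL T k q)) c)
      · intro i hi
        simp [hfT i hi, hs, hgT T k q i hi]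
      · intro i j hij
        have := hgen i j hij
        rw [Pi.sub_apply, Pi.smul_apply, coeff_sub, coeff_smul, hb i j hij, this]
        simp
      · intro j hj
        rw [Pi.sub_apply, Pi.smul_apply, coeff_sub, coeff_smul, coeff_X_pow_smul,
          if_pos (by omega)]
        rcases hj.eq_or_lt with rfl | hj
        · rw [hc, show d - (d - q.1) = q.1 by omega, smul_eq_mul, sub_self]
        · rw [hd j hj, hgd T k q _ (by omega)]
          simp

theorem exists_coeff_bound {S : Set (Fin n → ℤ[X])} (hS : S.Finite) :
    ∃ D : ℕ, ∀ s ∈ S, ∀ i j, D ≤ j → (s i).coeff j = 0 := by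
  refine ⟨hS.toFinset.sup fun s => Finset.univ.sup fun i => (s i).natDegree + 1,
    fun s hs i j hj => coeff_eq_zero_of_natDegree_lt ?_⟩
  have h1 := Finset.le_sup (f := fun s : Fin n → ℤ[X] => Finset.univ.sup fun i =>
    (s i).natDegree + 1) (hS.mem_toFinset.mpr hs)
  have h2 := Finset.le_sup (f := fun i => (s i).natDegree + 1) (Finset.mem_univ i)
  have h3 : (s i).natDegree + 1 ≤ _ := h2.trans h1
  omega

/-- Elements with small components on `C` agree on `C` with lattice elements which are small
everywhere, provided that the bounds outside `C` are sufficiently larger than those on `C`. -/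
theorem exists_gap_lift (L : Submodule ℤ[X] (Fin n → ℤ[X])) :
    ∃ D : ℕ, ∀ (C : Finset (Fin n)) (a : Fin n → ℕ) (t : ℕ), (∀ i ∈ C, a i + D ≤ t) →
      (∀ i ∉ C, t ≤ a i) → ∀ f ∈ L, (∀ i ∈ C, ∀ j, a i ≤ j → (f i).coeff j = 0) →
      ∃ g ∈ L, DegreesBelow a g ∧ ∀ i ∈ C, g i = f i := by
  classical
  let π : Finset (Fin n) → (Fin n → ℤ[X]) →ₗ[ℤ[X]] (Fin n → ℤ[X]) := fun C =>
    LinearMap.pi fun i => if i ∈ C then LinearMap.proj i else 0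
  have hπ : ∀ C f i, π C f i = if i ∈ C then f i else 0 := by
    intro C f i
    simp only [π, LinearMap.pi_apply]
    split_ifs <;> simp
  choose S hSfin hSL hS using
    fun C => exists_finite_degree_compatible_generators (L.map (π C))
  have hlift : ∀ C, ∀ s, ∃ t, s ∈ S C → t ∈ L ∧ π C t = s := by
    intro C s
    by_cases hs : s ∈ S C
    · obtain ⟨t, ht, rfl⟩ := hSL C hs
      exact ⟨t, fun _ => ⟨ht, rfl⟩⟩
    · exact ⟨0, fun h => absurd h hs⟩
  choose τ hτ using hlift
  obtain ⟨D, hD⟩ := exists_coeff_bound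
    (Set.finite_iUnion fun C => (hSfin C).image (τ C))
  refine ⟨D, fun C a t hC hC' f hf hfC => ?_⟩
  have key : ∀ w ∈ AddSubgroup.closure
      {g | ∃ s ∈ S C, ∃ e : ℕ, g = (X : ℤ[X]) ^ e • s ∧ DegreesBelow a g},
      ∃ g ∈ L, DegreesBelow a g ∧ π C g = w := by
    intro w hw
    induction hw using AddSubgroup.closure_induction with
    | mem w hw =>
      obtain ⟨s, hs, e, rfl, hb⟩ := hw
      obtain ⟨hsL, hsτ⟩ := hτ C s hs
      by_cases hs0 : s = 0
      · exact ⟨0, L.zero_mem, fun i j _ => by simp, by simp [hs0]⟩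
      refine ⟨(X : ℤ[X]) ^ e • τ C s, L.smul_mem _ hsL, fun i j hij => ?_, by rw [map_smul, hsτ]⟩
      by_cases hi : i ∈ C
      · have := hb i j hij
        rw [← hsτ, coeff_X_pow_smul, hπ, if_pos hi] at this
        rw [coeff_X_pow_smul, this]
      · obtain ⟨c, hc⟩ := Function.ne_iff.mp hs0
        have hcC : c ∈ C := by
          by_contra h
          exact hc (by rw [← hsτ, hπ, if_neg h]; rfl)
        have hec : e < a c := by
          by_contra! h
          apply hc
          ext j
          have := hb c (j + e) (by omega)
          rw [coeff_X_pow_smul, if_pos (by omega)] at this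
          simpa using this
        have h1 := hC c hcC
        have h2 := hC' i hi
        rw [coeff_X_pow_smul, if_pos (by omega)]
        exact hD _ (Set.mem_iUnion.mpr ⟨C, s, hs, rfl⟩) i _ (by omega)
    | zero => exact ⟨0, L.zero_mem, fun i j _ => by simp, by simp⟩
    | add x y _ _ hx hy =>
      obtain ⟨g, hg, hb, rfl⟩ := hx
      obtain ⟨g', hg', hb', rfl⟩ := hy
      exact ⟨g + g', L.add_mem hg hg', fun i j h => by simp [hb i j h, hb' i j h], by simp⟩
    | neg x _ hx =>
      obtain ⟨g, hg, hb, rfl⟩ := hx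
      exact ⟨-g, L.neg_mem hg, fun i j h => by simp [hb i j h], by simp⟩
  obtain ⟨g, hg, hb, hgf⟩ := key (π C f) (hS C a _ (Submodule.mem_map_of_mem hf) (by
    intro i j hij
    rw [hπ]
    split_ifs with hi
    · exact hfC i hi j hij
    · simp))
  refine ⟨g, hg, hb, fun i hi => ?_⟩
  have := congrFun hgf i
  rwa [hπ, hπ, if_pos hi, if_pos hi] at this

theorem exists_gap {ι : Type*} [DecidableEq ι] (a : ι → ℕ) (D : ℕ) (s : Finset ι) (x : ℕ) :
    ∃ t, t ≤ x ∧ x ≤ t + s.card * D ∧ ∀ i ∈ s, a i < t → a i + D ≤ t := by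
  induction hm : s.card generalizing s x with
  | zero => exact ⟨x, le_rfl, by simp, by simp [Finset.card_eq_zero.mp hm]⟩
  | succ m ih =>
    by_cases h : ∀ i ∈ s, a i < x → a i + D ≤ x
    · exact ⟨x, le_rfl, by omega, h⟩
    push Not at h
    obtain ⟨i, hi, h1, h2⟩ := h
    obtain ⟨t, ht1, ht2, ht3⟩ := ih (s.erase i) (a i) (by rw [Finset.card_erase_of_mem hi, hm]; rfl)
    refine ⟨t, by omega, by rw [add_mul]; omega, fun j hj hjt => ?_⟩
    by_cases hji : j = i
    · subst hji
      omega
    · exact ht3 j (Finset.mem_erase.mpr ⟨hji, hj⟩) hjt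

theorem exists_finite_bounded_witnesses (L : Submodule ℤ[X] (Fin n → ℤ[X])) (N : ℕ) :
    ∃ S : Set (Fin n → ℤ[X]), S.Finite ∧ S ⊆ L ∧ ∀ (C : Finset (Fin n)) (v : Fin n)
      (a : Fin n → ℕ) (t : ℕ), (∀ i ∉ C, t ≤ a i) → a v ≤ t + N →
      ∀ f ∈ L, (∀ i ∈ C, f i = 0) → PositiveAbove a f v →
      ∃ s ∈ S, ∃ e : ℕ, PositiveAbove a ((X : ℤ[X]) ^ e • s) v := by
  let P : Finset (Fin n) → Fin n → ℕ → ℕ × (Fin n → ℕ) → (Fin n → ℤ[X]) → Prop :=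
    fun C v w p f => p.2 v = w ∧ f ∈ L ∧ (∀ i ∈ C, f i = 0) ∧
      PositiveAbove (fun i => p.1 + p.2 i) f v
  choose F hFP hF using fun C v w => (wellQuasiOrdered_le
    (α := ℕ × (Fin n → ℕ))).exists_finset_basis (fun p => ∃ f, P C v w p f)
  have hch : ∀ C v w p, ∃ f, p ∈ F C v w → P C v w p f := by
    intro C v w p
    by_cases hp : p ∈ F C v w
    · obtain ⟨f, hf⟩ := hFP C v w p hp
      exact ⟨f, fun _ => hf⟩
    · exact ⟨0, fun h => absurd h hp⟩
  choose g hg using hch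
  refine ⟨⋃ C, ⋃ v, ⋃ w ∈ Finset.range (N + 1), g C v w '' F C v w,
    Set.finite_iUnion fun C => Set.finite_iUnion fun v =>
      (Finset.range (N + 1)).finite_toSet.biUnion fun w _ => (F C v w).finite_toSet.image _, ?_, ?_⟩
  · simp only [Set.iUnion_subset_iff, Set.image_subset_iff]
    exact fun C v w _ p hp => (hg C v w p hp).2.1
  intro C v a t hC hav f hf hfC hfp
  have hvC : v ∉ C := by
    intro h
    obtain ⟨j, -, hj⟩ := hfp.2
    simp [hfC v h] at hj
  have hav' := hC v hvC
  obtain ⟨p, hp, hp1, hp2⟩ := hF C v (a v - t) (t, fun i => a i - t) ⟨f, rfl, hf, hfC, by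
    refine ⟨fun i j hij => ?_, ?_⟩
    · by_cases hi : i ∈ C
      · simp [hfC i hi]
      · have := hC i hi
        exact hfp.1 i j (by simp only at hij; omega)
    · obtain ⟨j, hj, hj'⟩ := hfp.2
      exact ⟨j, by simp only; omega, hj'⟩⟩
  obtain ⟨hw, -, hsC, hsp, j, hj, hj'⟩ := hg C v (a v - t) p hp
  simp only at hp1 hp2 hj hw
  refine ⟨g C v (a v - t) p, ?_, t - p.1, fun i j hij => ?_, j + (t - p.1), by omega, ?_⟩
  · simp only [Set.mem_iUnion]
    exact ⟨C, v, a v - t, Finset.mem_range.mpr (by omega), p, hp, rfl⟩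
  · by_cases hi : i ∈ C
    · simp [hsC i hi]
    · have h1 := hC i hi
      have h2 : p.2 i ≤ a i - t := hp2 i
      rw [coeff_X_pow_smul]
      split_ifs
      · exact hsp i _ (by dsimp only; omega)
      · rfl
  · rw [coeff_X_pow_smul, if_pos (by omega), Nat.add_sub_cancel]
    exact hj'

/-- Finitely many lattice elements witness, up to powers of `x`, every multidegree bound that some
lattice element exceeds with positive coefficients only. -/
theorem exists_finite_positive_witnesses (L : Submodule ℤ[X] (Fin n → ℤ[X])) :
    ∃ S : Set (Fin n → ℤ[X]), S.Finite ∧ S ⊆ L ∧ ∀ (a : Fin n → ℕ) (v : Fin n), ∀ f ∈ L,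
      PositiveAbove a f v → ∃ s ∈ S, ∃ e : ℕ, ∃ w, a w ≤ a v ∧
        PositiveAbove a ((X : ℤ[X]) ^ e • s) w := by
  classical
  obtain ⟨D, hD⟩ := exists_gap_lift L
  obtain ⟨S, hSfin, hSL, hS⟩ := exists_finite_bounded_witnesses L (n * D)
  refine ⟨S, hSfin, hSL, fun a v₀ f hf hfp₀ => ?_⟩
  obtain ⟨v, hv, hmin⟩ := Finset.exists_min_image
    (Finset.univ.filter fun v => PositiveAbove a f v) a ⟨v₀, by simpa using hfp₀⟩
  have hfp : PositiveAbove a f v := by simpa using hv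
  obtain ⟨t, ht1, ht2, ht3⟩ := exists_gap a D Finset.univ (a v)
  simp only [Finset.card_univ, Fintype.card_fin] at ht2
  obtain ⟨g, hg, hgb, hgf⟩ := hD (Finset.univ.filter fun i => a i < t) a t
    (fun i hi => ht3 i (Finset.mem_univ i) (by simpa using hi)) (fun i hi => by simpa using hi)
    f hf (fun i hi j hij => by
      by_contra hne
      have := hmin i (by
        simp only [Finset.mem_filter, Finset.mem_univ, true_and]
        exact ⟨hfp.1, j, hij, lt_of_le_of_ne (hfp.1 i j hij) (Ne.symm hne)⟩)
      simp only [Finset.mem_filter, Finset.mem_univ, true_and] at hi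
      omega)
  have hco : ∀ i j, a i ≤ j → ((f - g) i).coeff j = (f i).coeff j := fun i j hij => by
    simp [hgb i j hij]
  obtain ⟨s, hs, e, hse⟩ := hS (Finset.univ.filter fun i => a i < t) v a t
    (fun i hi => by simpa using hi) ht2 (f - g) (L.sub_mem hf hg)
    (fun i hi => by simp [hgf i hi])
    ⟨fun i j hij => by rw [hco i j hij]; exact hfp.1 i j hij, by
      obtain ⟨j, hj, hj'⟩ := hfp.2
      exact ⟨j, hj, by rw [hco v j hj]; exact hj'⟩⟩
  exact ⟨s, hs, e, v, hmin v₀ (by simpa using hfp₀), hse⟩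

end Lattice

section Primes

variable {R : Type*} [CommRing R] {σ : R →+* R}

theorem Ideal.exists_notMem_mul_mem_of_mem_minimalPrimes {I P : Ideal R} (hI : I.IsRadical)
    (hP : P ∈ I.minimalPrimes) {a : R} (ha : a ∈ P) : ∃ b ∉ P, b * a ∈ I := by
  have := hP.1.1
  by_contra! h
  have hdisj : Disjoint (I : Set R) ((P.primeCompl ⊔ Submonoid.powers a : Submonoid R) : Set R) := by
    rw [Set.disjoint_left]
    rintro x hxI hx
    obtain ⟨b, hb, _, ⟨m, rfl⟩, rfl⟩ := Submonoid.mem_sup.mp hx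
    refine h b hb (hI ⟨m + 1, ?_⟩)
    have : (b * a) ^ (m + 1) = (b ^ m * a) * (b * a ^ m) := by ring
    rw [this]
    exact I.mul_mem_left _ hxI
  obtain ⟨Q, hQ, hIQ, hQd⟩ := Ideal.exists_le_prime_disjoint I _ hdisj
  rw [Set.disjoint_left] at hQd
  have hQP : Q ≤ P := fun x hx => by
    by_contra hxP
    exact hQd hx (Submonoid.mem_sup_left (show x ∈ P.primeCompl from hxP))
  exact hQd (hP.2 ⟨hQ, hIQ⟩ hQP ha) (Submonoid.mem_sup_right (Submonoid.mem_powers a))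

/-- The minimal primes over a radical well-mixed ideal are closed under `σ`. -/
theorem IsWellMixed.isSigmaIdeal_of_mem_minimalPrimes {I P : Ideal R} (hw : IsWellMixed σ I)
    (hr : I.IsRadical) (hP : P ∈ I.minimalPrimes) : IsSigmaIdeal σ P := by
  intro a ha
  obtain ⟨b, hb, hba⟩ := Ideal.exists_notMem_mul_mem_of_mem_minimalPrimes hr hP ha
  exact (hP.1.1.mem_or_mem (hP.1.2 (hw b a hba))).resolve_left hb

theorem subset_rwmClosure (F : Set R) : F ⊆ rwmClosure σ F := fun _ hx =>
  Ideal.mem_sInf.mpr fun {_} hI => hI.1 hx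

theorem rwmClosure_le {F : Set R} {I : Ideal R} (hF : F ⊆ I) (hs : IsSigmaIdeal σ I)
    (hw : IsWellMixed σ I) (hr : I.IsRadical) : rwmClosure σ F ≤ I :=
  sInf_le ⟨hF, hs, hw, hr⟩

theorem isSigmaIdeal_rwmClosure (F : Set R) : IsSigmaIdeal σ (rwmClosure σ F) := fun a ha =>
  Ideal.mem_sInf.mpr fun {_} hI => hI.2.1 a (Ideal.mem_sInf.mp ha hI)

theorem isWellMixed_rwmClosure (F : Set R) : IsWellMixed σ (rwmClosure σ F) := fun a b hab =>
  Ideal.mem_sInf.mpr fun {_} hI => hI.2.2.1 a b (Ideal.mem_sInf.mp hab hI)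

theorem isRadical_rwmClosure (F : Set R) : (rwmClosure σ F).IsRadical := by
  rintro a ⟨m, hm⟩
  exact Ideal.mem_sInf.mpr fun {_} hI => hI.2.2.2 ⟨m, Ideal.mem_sInf.mp hm hI⟩

/-- Membership in a radical well-mixed closure can be tested on prime ideals closed under `σ`. -/
theorem mem_rwmClosure_of_forall_prime {F : Set R} {x : R}
    (h : ∀ P : Ideal R, P.IsPrime → IsSigmaIdeal σ P → F ⊆ P → x ∈ P) : x ∈ rwmClosure σ F := by
  rw [← (isRadical_rwmClosure (σ := σ) F).radical, ← Ideal.sInf_minimalPrimes]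
  exact Ideal.mem_sInf.mpr fun {P} hP => h P hP.1.1
    ((isWellMixed_rwmClosure F).isSigmaIdeal_of_mem_minimalPrimes (isRadical_rwmClosure F) hP)
    ((subset_rwmClosure F).trans hP.1.2)

theorem sexp_eq_prod_range (a : R) {p : ℕ[X]} {N : ℕ} (hN : p.natDegree < N) :
    sexp σ a p = ∏ i ∈ Finset.range N, ((⇑σ)^[i] a) ^ p.coeff i := by
  refine Finset.prod_subset (Finset.range_subset_range.mpr hN) fun i _ hi => ?_
  rw [coeff_eq_zero_of_natDegree_lt (by simpa using hi), pow_zero]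

theorem sexp_X_mul (a : R) (p : ℕ[X]) : sexp σ a (X * p) = σ (sexp σ a p) := by
  rw [sexp_eq_prod_range a (N := p.natDegree + 1 + 1)
      (by have := natDegree_mul_le (p := X) (q := p); have := natDegree_X_le (R := ℕ); omega),
    Finset.prod_range_succ', sexp, map_prod]
  simp [Function.iterate_succ_apply']

end Primes

section Monomials

variable {K : Type*} [Field K] {n : ℕ} (σK : K →+* K)

theorem posPart_coeff (f : ℤ[X]) (j : ℕ) : (_root_.posPart f).coeff j = (f.coeff j).toNat := by
  rw [_root_.posPart, Polynomial.sum, finsetSum_coeff]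
  simp only [coeff_monomial]
  rw [Finset.sum_ite_eq']
  split_ifs with h
  · rfl
  · simp [notMem_support_iff.mp h]

theorem negPart_coeff (f : ℤ[X]) (j : ℕ) : (_root_.negPart f).coeff j = (-f.coeff j).toNat := by
  rw [_root_.negPart, Polynomial.sum, finsetSum_coeff]
  simp only [coeff_monomial]
  rw [Finset.sum_ite_eq']
  split_ifs with h
  · rfl
  · simp [notMem_support_iff.mp h]

theorem posPart_X_mul (f : ℤ[X]) : _root_.posPart (X * f) = X * _root_.posPart f := by
  ext j
  cases j <;> simp [posPart_coeff]

theorem negPart_X_mul (f : ℤ[X]) : _root_.negPart (X * f) = X * _root_.negPart f := by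
  ext j
  cases j <;> simp [negPart_coeff]

/-- The pure binomial `Y^{f_+} − Y^{f_−}`. -/
noncomputable def latticeBinomial (f : Fin n → ℤ[X]) : DPoly K n :=
  monom σK (fun i => posPart (f i)) - monom σK (fun i => negPart (f i))

theorem latticeBinomial_X_smul (f : Fin n → ℤ[X]) :
    latticeBinomial σK ((X : ℤ[X]) • f) = shift σK (latticeBinomial σK f) := by
  simp [latticeBinomial, monom, ypow, posPart_X_mul, negPart_X_mul, sexp_X_mul]

theorem latticeBinomial_X_pow_smul_mem {P : Ideal (DPoly K n)} (hP : IsSigmaIdeal (shift σK) P)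
    {f : Fin n → ℤ[X]} (hf : latticeBinomial σK f ∈ P) (e : ℕ) :
    latticeBinomial σK ((X : ℤ[X]) ^ e • f) ∈ P := by
  induction e with
  | zero => simpa using hf
  | succ e ih =>
    rw [pow_succ', mul_smul, latticeBinomial_X_smul]
    exact hP _ ih

theorem shift_iterate_X (i : Fin n) (j : ℕ) :
    (⇑(shift σK))^[j] (MvPolynomial.X (i, 0)) = MvPolynomial.X (i, j) := by
  induction j with
  | zero => rfl
  | succ j ih => rw [Function.iterate_succ_apply', ih]; simp [shift]

/-- The exponent of the monomial `Y^f`, as a finitely supported function on the variables. -/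
noncomputable def exponent (f : Fin n → ℕ[X]) : Fin n × ℕ →₀ ℕ :=
  ∑ i, ∑ j ∈ Finset.range ((f i).natDegree + 1), Finsupp.single (i, j) ((f i).coeff j)

theorem exponent_apply (f : Fin n → ℕ[X]) (i : Fin n) (j : ℕ) :
    exponent f (i, j) = (f i).coeff j := by
  classical
  simp only [exponent, Finsupp.finsetSum_apply]
  rw [Finset.sum_eq_single i _ (by simp)]
  · rcases Nat.lt_or_ge (f i).natDegree j with h | h
    · rw [coeff_eq_zero_of_natDegree_lt h]
      refine Finset.sum_eq_zero fun k hk => Finsupp.single_eq_of_ne ?_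
      simp only [Finset.mem_range] at hk
      simp only [ne_eq, Prod.mk.injEq, true_and]
      omega
    · rw [Finset.sum_eq_single j]
      · simp
      · exact fun k _ hk => Finsupp.single_eq_of_ne (by simp [Ne.symm hk])
      · intro hj
        simp at hj
        omega
  · intro k _ hk
    exact Finset.sum_eq_zero fun l _ => Finsupp.single_eq_of_ne (by simp [Ne.symm hk])

theorem monom_eq_monomial (f : Fin n → ℕ[X]) :
    monom σK f = MvPolynomial.monomial (exponent f) 1 := by
  simp only [monom, ypow, sexp, shift_iterate_X, MvPolynomial.X_pow_eq_monomial, exponent,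
    MvPolynomial.monomial_sum_one]

theorem monomial_mem_prime_iff {P : Ideal (DPoly K n)} [hP : P.IsPrime] (e : Fin n × ℕ →₀ ℕ) :
    MvPolynomial.monomial e (1 : K) ∈ P ↔ ∃ v, e v ≠ 0 ∧ (MvPolynomial.X v : DPoly K n) ∈ P := by
  rw [MvPolynomial.monomial_eq, map_one, one_mul, Finsupp.prod, hP.prod_mem_iff]
  constructor
  · rintro ⟨v, hv, h⟩
    exact ⟨v, Finsupp.mem_support_iff.mp hv, hP.mem_of_pow_mem _ h⟩
  · rintro ⟨v, hv, h⟩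
    exact ⟨v, Finsupp.mem_support_iff.mpr hv, P.pow_mem_of_mem h _ (Nat.pos_of_ne_zero hv)⟩

theorem monom_posPart_mem_prime_iff {P : Ideal (DPoly K n)} [P.IsPrime] (f : Fin n → ℤ[X]) :
    monom σK (fun i => posPart (f i)) ∈ P ↔
      ∃ i j, 0 < (f i).coeff j ∧ (MvPolynomial.X (i, j) : DPoly K n) ∈ P := by
  rw [monom_eq_monomial, monomial_mem_prime_iff]
  simp only [Prod.exists, exponent_apply, posPart_coeff]
  refine exists_congr fun i => exists_congr fun j => and_congr_left fun _ => ?_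
  omega

theorem monom_negPart_mem_prime_iff {P : Ideal (DPoly K n)} [P.IsPrime] (f : Fin n → ℤ[X]) :
    monom σK (fun i => negPart (f i)) ∈ P ↔
      ∃ i j, (f i).coeff j < 0 ∧ (MvPolynomial.X (i, j) : DPoly K n) ∈ P := by
  rw [monom_eq_monomial, monomial_mem_prime_iff]
  simp only [Prod.exists, exponent_apply, negPart_coeff]
  refine exists_congr fun i => exists_congr fun j => and_congr_left fun _ => ?_
  omega

/-- If the variables below the bounds `a` do not lie in the prime `P`, then the set of `f` with
degrees below `a` and `Y^{f_+} − Y^{f_−} ∈ P` is closed under the group operations. -/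
theorem latticeBinomial_mem_of_mem_closure {P : Ideal (DPoly K n)} [hP : P.IsPrime] {a : Fin n → ℕ}
    (ha : ∀ i j, j < a i → (MvPolynomial.X (i, j) : DPoly K n) ∉ P) {S : Set (Fin n → ℤ[X])}
    (hS : ∀ s ∈ S, DegreesBelow a s ∧ latticeBinomial σK s ∈ P) {f : Fin n → ℤ[X]}
    (hf : f ∈ AddSubgroup.closure S) : latticeBinomial σK f ∈ P := by
  suffices H : ∃ p q : Fin n × ℕ →₀ ℕ, (∀ i j, (f i).coeff j = (p (i, j) : ℤ) - q (i, j)) ∧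
      (∀ i j, a i ≤ j → p (i, j) = 0 ∧ q (i, j) = 0) ∧
      MvPolynomial.monomial p (1 : K) - MvPolynomial.monomial q 1 ∈ P by
    obtain ⟨p, q, hpq, hp, hmem⟩ := H
    set u := exponent fun i => posPart (f i) with hu
    set w := exponent fun i => negPart (f i) with hw
    have hup : u + (p - u) = p := by
      ext ⟨i, j⟩
      have := hpq i j
      simp only [Finsupp.add_apply, Finsupp.tsub_apply, hu, exponent_apply, posPart_coeff]
      omega
    have hwq : w + (p - u) = q := by
      ext ⟨i, j⟩
      have := hpq i j
      simp only [Finsupp.add_apply, Finsupp.tsub_apply, hu, hw, exponent_apply, posPart_coeff,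
        negPart_coeff]
      omega
    have hfac : MvPolynomial.monomial p (1 : K) - MvPolynomial.monomial q 1 =
        latticeBinomial σK f * MvPolynomial.monomial (p - u) 1 := by
      rw [latticeBinomial, monom_eq_monomial, monom_eq_monomial, sub_mul,
        MvPolynomial.monomial_mul, MvPolynomial.monomial_mul, hup, hwq, one_mul]
    rw [hfac] at hmem
    refine (hP.mem_or_mem hmem).resolve_right fun h => ?_
    obtain ⟨⟨i, j⟩, hv, hX⟩ := (monomial_mem_prime_iff _).mp h
    refine ha i j ?_ hX
    by_contra! hij
    exact hv (by simp [(hp i j hij).1])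
  induction hf using AddSubgroup.closure_induction with
  | mem s hs =>
    obtain ⟨hb, hm⟩ := hS s hs
    refine ⟨exponent fun i => posPart (s i), exponent fun i => negPart (s i), fun i j => ?_,
      fun i j hij => ?_, by simpa only [latticeBinomial, monom_eq_monomial] using hm⟩
    · rw [exponent_apply, exponent_apply, posPart_coeff, negPart_coeff]
      omega
    · simp [exponent_apply, posPart_coeff, negPart_coeff, hb i j hij]
  | zero => exact ⟨0, 0, by simp, by simp, by simp⟩
  | add x y _ _ hx hy =>
    obtain ⟨p, q, h, hp, hm⟩ := hx
    obtain ⟨p', q', h', hp', hm'⟩ := hy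
    refine ⟨p + p', q + q', fun i j => ?_, fun i j hij => ?_, ?_⟩
    · simp only [Pi.add_apply, coeff_add, h, h', Finsupp.add_apply]
      push_cast
      ring
    · simp [(hp i j hij).1, (hp i j hij).2, (hp' i j hij).1, (hp' i j hij).2]
    · have : MvPolynomial.monomial (p + p') (1 : K) - MvPolynomial.monomial (q + q') 1 =
          MvPolynomial.monomial p' 1 * (MvPolynomial.monomial p 1 - MvPolynomial.monomial q 1) +
          MvPolynomial.monomial q 1 * (MvPolynomial.monomial p' 1 - MvPolynomial.monomial q' 1) := by
        rw [← one_mul (1 : K), ← MvPolynomial.monomial_mul, ← MvPolynomial.monomial_mul, one_mul]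
        ring
      rw [this]
      exact P.add_mem (P.mul_mem_left _ hm) (P.mul_mem_left _ hm')
  | neg x _ hx =>
    obtain ⟨p, q, h, hp, hm⟩ := hx
    refine ⟨q, p, fun i j => ?_, fun i j hij => (hp i j hij).symm, ?_⟩
    · simp only [Pi.neg_apply, coeff_neg, h]
      ring
    · rw [← neg_sub]
      exact P.neg_mem hm

theorem X_mem_of_le {P : Ideal (DPoly K n)} (hP : IsSigmaIdeal (shift σK) P) {i : Fin n} {j k : ℕ}
    (hj : (MvPolynomial.X (i, j) : DPoly K n) ∈ P) (hjk : j ≤ k) :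
    (MvPolynomial.X (i, k) : DPoly K n) ∈ P := by
  induction k, hjk using Nat.le_induction with
  | base => exact hj
  | succ k _ ih => simpa [shift] using hP _ ih

/-- A prime containing the binomial of `f` contains both or neither of its monomials, so `f` cannot
have only positive coefficients among the variables lying in the prime. -/
theorem not_positiveAbove {P : Ideal (DPoly K n)} [P.IsPrime] (hP : IsSigmaIdeal (shift σK) P)
    {a : Fin n → ℕ} (ha : ∀ i j, j < a i → (MvPolynomial.X (i, j) : DPoly K n) ∉ P)
    {f : Fin n → ℤ[X]} (hf : latticeBinomial σK f ∈ P) {v : Fin n}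
    (hv : (MvPolynomial.X (v, a v) : DPoly K n) ∈ P) : ¬ PositiveAbove a f v := by
  rintro ⟨hnonneg, j, hj, hj'⟩
  have hp := (monom_posPart_mem_prime_iff σK f).mpr ⟨v, j, hj', X_mem_of_le σK hP hv hj⟩
  have hm : monom σK (fun i => negPart (f i)) ∈ P := (Submodule.sub_mem_iff_right _ hp).mp hf
  obtain ⟨i, k, hk, hX⟩ := (monom_negPart_mem_prime_iff σK f).mp hm
  rcases Nat.lt_or_ge k (a i) with h | h
  · exact ha i k h hX
  · exact absurd (hnonneg i k h) (by omega)

/-- Finitely many lattice elements suffice to generate the lattice σ-ideal modulo all prime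
σ-closed ideals. -/
theorem exists_finite_latticeBinomial_generators (L : Submodule ℤ[X] (Fin n → ℤ[X])) :
    ∃ S : Set (Fin n → ℤ[X]), S.Finite ∧ S ⊆ L ∧ ∀ P : Ideal (DPoly K n), P.IsPrime →
      IsSigmaIdeal (shift σK) P → (∀ s ∈ S, latticeBinomial σK s ∈ P) →
      ∀ f ∈ L, latticeBinomial σK f ∈ P := by
  obtain ⟨S, hSfin, hSL, hS⟩ := exists_finite_degree_compatible_generators L
  obtain ⟨S', hSfin', hSL', hS'⟩ := exists_finite_positive_witnesses L
  refine ⟨S ∪ S', hSfin.union hSfin', Set.union_subset hSL hSL', fun P hprime hσ hSP f hf => ?_⟩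
  obtain ⟨N, hN⟩ := exists_coeff_bound (Set.finite_singleton f)
  replace hN := hN f rfl
  let a : Fin n → ℕ := fun i => sInf {j | (MvPolynomial.X (i, j) : DPoly K n) ∈ P ∨ N ≤ j}
  have ha : ∀ i j, j < a i → (MvPolynomial.X (i, j) : DPoly K n) ∉ P := fun i j hj hX =>
    Nat.notMem_of_lt_sInf hj (Or.inl hX)
  have haN : ∀ i, a i < N → (MvPolynomial.X (i, a i) : DPoly K n) ∈ P := fun i hi =>
    (Nat.sInf_mem (s := {j | (MvPolynomial.X (i, j) : DPoly K n) ∈ P ∨ N ≤ j})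
      ⟨N, Or.inr le_rfl⟩).resolve_right (by simpa [a] using hi)
  have hmem : ∀ i j, a i ≤ j → (f i).coeff j ≠ 0 → (MvPolynomial.X (i, j) : DPoly K n) ∈ P := by
    intro i j hij hne
    have : j < N := by
      by_contra! h
      exact hne (hN i j h)
    exact X_mem_of_le σK hσ (haN i (by omega)) hij
  have hno : ∀ g ∈ L, (∀ i j, N ≤ j → (g i).coeff j = 0) → ∀ v, ¬ PositiveAbove a g v := by
    intro g hg hgN v hv
    obtain ⟨s, hs, e, w, hwv, hw⟩ := hS' a v g hg hv
    obtain ⟨-, j, hj, hj'⟩ := hv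
    have : j < N := by
      by_contra! h
      simp [hgN v j h] at hj'
    exact not_positiveAbove σK hσ ha
      (latticeBinomial_X_pow_smul_mem σK hσ (hSP s (Or.inr hs)) e) (haN w (by omega)) hw
  by_cases hbelow : DegreesBelow a f
  · refine latticeBinomial_mem_of_mem_closure σK ha ?_ (hS a f hf hbelow)
    rintro _ ⟨s, hs, e, rfl, hb⟩
    exact ⟨hb, latticeBinomial_X_pow_smul_mem σK hσ (hSP s (Or.inl hs)) e⟩
  have hpos : ∃ i j, a i ≤ j ∧ 0 < (f i).coeff j := by
    by_contra! h
    simp only [DegreesBelow, not_forall] at hbelow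
    obtain ⟨i, j, hij, hne⟩ := hbelow
    refine hno (-f) (L.neg_mem hf) (fun i j hij => by simp [hN i j hij]) i
      ⟨fun i j hij => by simpa using h i j hij, j, hij, ?_⟩
    simpa using lt_of_le_of_ne (h i j hij) hne
  have hneg : ∃ i j, a i ≤ j ∧ (f i).coeff j < 0 := by
    by_contra! h
    obtain ⟨i, j, hij, hlt⟩ := hpos
    exact hno f hf hN i ⟨h, j, hij, hlt⟩
  obtain ⟨i, j, hij, hlt⟩ := hpos
  obtain ⟨i', j', hij', hlt'⟩ := hneg
  exact P.sub_mem
    ((monom_posPart_mem_prime_iff σK f).mpr ⟨i, j, hlt, hmem i j hij hlt.ne'⟩)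
    ((monom_negPart_mem_prime_iff σK f).mpr ⟨i', j', hlt', hmem i' j' hij' hlt'.ne⟩)

end Monomials

/-- For any ℤ[x]-lattice `L ⊆ ℤ[x]^n`, the radical well-mixed closure `⟨I_L⟩_r`
is generated, as a radical well-mixed σ-ideal, by a finite set of pure binomials in it. -/
theorem stmt0 {K : Type*} [Field K] [CharZero K] {n : ℕ} (σK : K →+* K)
    (L : Submodule (Polynomial ℤ) (Fin n → Polynomial ℤ)) :
    ∃ G : Set (DPoly K n), G.Finite ∧ (∀ p ∈ G, IsPureBinomial σK p) ∧
      G ⊆ (rwmClosure (shift σK) ((latticeIdeal σK L : Ideal (DPoly K n)) : Set (DPoly K n)) :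
        Set (DPoly K n)) ∧
      rwmClosure (shift σK) ((latticeIdeal σK L : Ideal (DPoly K n)) : Set (DPoly K n)) =
        rwmClosure (shift σK) G := by
  obtain ⟨S, hSfin, hSL, hS⟩ := exists_finite_latticeBinomial_generators σK L
  have hG : latticeBinomial σK '' S ⊆
      (rwmClosure (shift σK) ((latticeIdeal σK L : Ideal (DPoly K n)) : Set (DPoly K n)) :
        Set (DPoly K n)) := by
    rintro _ ⟨s, hs, rfl⟩
    exact subset_rwmClosure _ (Ideal.mem_sInf.mpr fun {_} hI => hI.1 ⟨s, hSL hs, rfl⟩)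
  refine ⟨latticeBinomial σK '' S, hSfin.image _, ?_, hG, le_antisymm ?_ ?_⟩
  · rintro _ ⟨s, -, rfl⟩
    exact ⟨_, _, rfl⟩
  · refine rwmClosure_le ?_ (isSigmaIdeal_rwmClosure _) (isWellMixed_rwmClosure _)
      (isRadical_rwmClosure _)
    refine SetLike.coe_subset_coe.mpr (sInf_le ⟨?_, isSigmaIdeal_rwmClosure _⟩)
    rintro _ ⟨f, hf, rfl⟩
    exact mem_rwmClosure_of_forall_prime fun P hP hσ hGP =>
      hS P hP hσ (fun s hs => hGP ⟨s, hs, rfl⟩) f hf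
  · exact rwmClosure_le hG (isSigmaIdeal_rwmClosure _) (isWellMixed_rwmClosure _)
      (isRadical_rwmClosure _)
end

section
/- Let L ⊆ ℤ[x]^n be a ℤ[x]-lattice such that the lattice σ-ideal I_L ⊆ K{y_1,…,y_n} is well-mixed. Then I_L is finitely generated as a radical well-mixed σ-ideal, i.e., I_L = ⟨G⟩_r for some finite set G ⊆ I_L. -/
open Polynomial

open Filter in
theorem Ultrafilter.exists_eventually_of_finite {α β : Type*} (U : Ultrafilter α) (t : Finset β)
    (P : β → α → Prop) (h : ∀ᶠ s in U, ∃ b ∈ t, P b s) : ∃ b ∈ t, ∀ᶠ s in U, P b s :=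
  (U.eventually_exists_mem_iff t.finite_toSet).1 h

open Filter in
theorem Ultrafilter.exists_eventually_max {α β γ : Type*} [LinearOrder γ] (U : Ultrafilter α)
    (t : Finset β) (ht : t.Nonempty) (κ : α → β → γ) :
    ∃ m ∈ t, ∀ᶠ s in U, ∀ m' ∈ t, κ s m' ≤ κ s m := by
  refine U.exists_eventually_of_finite t (fun m s => ∀ m' ∈ t, κ s m' ≤ κ s m) (.of_forall ?_)
  intro s
  exact t.exists_max_image (κ s) ht

/-- Integer exponent vectors of the monomials in the variables `y_i^{x^j}`. -/
abbrev ExpVec (n : ℕ) := (Fin n × ℕ) →₀ ℤ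

/-- Multiplication by `x^e` on exponent vectors. -/
noncomputable def expShift {n : ℕ} (e : ℕ) : ExpVec n →+ ExpVec n :=
  Finsupp.mapDomain.addMonoidHom fun v => (v.1, v.2 + e)

section ExpShift

variable {n : ℕ}

theorem shiftIndex_injective (e : ℕ) :
    Function.Injective fun v : Fin n × ℕ => (v.1, v.2 + e) := by
  rintro ⟨i, j⟩ ⟨i', j'⟩ h
  simpa using h

theorem expShift_apply_add (e : ℕ) (f : ExpVec n) (i : Fin n) (j : ℕ) :
    expShift e f (i, j + e) = f (i, j) :=
  Finsupp.mapDomain_apply (shiftIndex_injective e) f (i, j)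

theorem expShift_apply (e : ℕ) (f : ExpVec n) (i : Fin n) (j : ℕ) :
    expShift e f (i, j) = if e ≤ j then f (i, j - e) else 0 := by
  split_ifs with h
  · obtain ⟨k, rfl⟩ := Nat.exists_eq_add_of_le' h
    rw [expShift_apply_add, Nat.add_sub_cancel]
  · refine Finsupp.mapDomain_of_notMem_range f _ ?_
    rintro ⟨⟨i', j'⟩, h'⟩
    simp only [Prod.mk.injEq] at h'
    omega

theorem expShift_expShift (e e' : ℕ) (f : ExpVec n) :
    expShift e (expShift e' f) = expShift (e + e') f := by
  ext ⟨i, j⟩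
  simp only [expShift_apply]
  split_ifs <;> first | rfl | omega | (congr 2; omega)

theorem expShift_zero (f : ExpVec n) : expShift 0 f = f := by
  ext ⟨i, j⟩
  simp [expShift_apply]

/-- A subgroup of exponent vectors closed under multiplication by powers of `x`. -/
def ShiftStable (Λ : AddSubgroup (ExpVec n)) : Prop := ∀ f ∈ Λ, ∀ e, expShift e f ∈ Λ

/-- `f` only involves the variables `y_i^{x^j}` with `j < a i`. -/
def InBox (a : Fin n → ℕ) (f : ExpVec n) : Prop := ∀ i j, a i ≤ j → f (i, j) = 0

theorem exists_reduced (κ : Fin n × ℕ → ℕ) (hκ : Function.Injective κ) (c : Fin n × ℕ → ℤ)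
    (hc0 : ∀ m, 0 ≤ c m) (T : AddSubgroup (ExpVec n)) (B : ℕ)
    (h : ∀ m, κ m < B → c m ≠ 0 → ∃ h ∈ T, h m = c m ∧ ∀ m', h m' ≠ 0 → κ m' ≤ κ m) :
    ∀ N ≤ B, ∀ f : ExpVec n, (∀ m, f m ≠ 0 → κ m < N) →
      ∃ r : ExpVec n, f - r ∈ T ∧ (∀ m, r m ≠ 0 → κ m < N) ∧
        ∀ m, c m ≠ 0 → 0 ≤ r m ∧ r m < c m := by
  classical
  intro N
  induction N with
  | zero =>
    intro _ f hf
    refine ⟨0, ?_, by simp, fun m hm => ⟨le_rfl, lt_of_le_of_ne (hc0 m) hm.symm⟩⟩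
    have : f = 0 := by
      ext m
      by_contra h
      exact absurd (hf m h) (by omega)
    simp [this]
  | succ N ih =>
    intro hN f hf
    by_cases hm : ∃ m, κ m = N
    · obtain ⟨m, hm⟩ := hm
      obtain ⟨g, hgT, hg1, hg2⟩ : ∃ g ∈ T, (c m ≠ 0 → 0 ≤ f m - g m ∧ f m - g m < c m) ∧
          ∀ m', g m' ≠ 0 → κ m' ≤ κ m := by
        by_cases hcm : c m = 0
        · exact ⟨0, T.zero_mem, fun h => absurd hcm h, by simp⟩
        · obtain ⟨g, hgT, hgm, hg⟩ := h m (by omega) hcm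
          refine ⟨(f m / c m) • g, T.zsmul_mem hgT _, fun _ => ?_, fun m' hm' => hg m' ?_⟩
          · have : f m - ((f m / c m) • g) m = f m % c m := by
              rw [Finsupp.smul_apply, hgm, smul_eq_mul, Int.emod_def, mul_comm]
            rw [this]
            exact ⟨Int.emod_nonneg _ hcm, Int.emod_lt_of_pos _ ((hc0 m).lt_of_ne' hcm)⟩
          · rintro h0
            simp [h0] at hm'
      obtain ⟨r, hr1, hr2, hr3⟩ := ih (by omega) ((f - g).erase m) (by
        intro m' hm'
        have hne : m' ≠ m := by rintro rfl; simp at hm'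
        rw [Finsupp.erase_ne hne, Finsupp.sub_apply] at hm'
        have h1 : κ m' ≤ N := by
          by_cases hf0 : f m' = 0
          · have := hg2 m' (by intro h0; simp [h0, hf0] at hm')
            omega
          · have := hf m' hf0
            omega
        have h2 : κ m' ≠ N := fun h => hne (hκ (h.trans hm.symm))
        omega)
      have hrm : r m = 0 := by
        by_contra h0
        have := hr2 m h0
        omega
      refine ⟨r + Finsupp.single m (f m - g m), ?_, ?_, ?_⟩
      · have : f - (r + Finsupp.single m (f m - g m)) = ((f - g).erase m - r) + g := by
          have h2 := Finsupp.erase_add_single m (f - g)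
          rw [Finsupp.sub_apply] at h2
          rw [← sub_eq_zero]
          have h3 : f - (r + Finsupp.single m (f m - g m)) - ((f - g).erase m - r + g) =
            (f - g) - ((f - g).erase m + Finsupp.single m (f m - g m)) := by abel
          rw [h3, h2, sub_self]
        rw [this]
        exact T.add_mem hr1 hgT
      · intro m' hm'
        by_cases hne : m' = m
        · subst hne; omega
        · rw [Finsupp.add_apply, Finsupp.single_eq_of_ne hne, add_zero] at hm'
          have := hr2 m' hm'
          omega
      · intro m' hm'
        by_cases hne : m' = m
        · subst hne
          simpa [hrm] using hg1 hm'
        · rw [Finsupp.add_apply, Finsupp.single_eq_of_ne hne, add_zero]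
          exact hr3 m' hm'
    · obtain ⟨r, hr1, hr2, hr3⟩ := ih (by omega) f (fun m h0 => by
        have := hf m h0
        have h2 : κ m ≠ N := fun h => hm ⟨m, h⟩
        omega)
      exact ⟨r, hr1, fun m h0 => (hr2 m h0).trans (by omega), hr3⟩

/-- A weight ordering on the variables for which `InBox a` is an initial segment. -/
def boxKey (a : Fin n → ℕ) (v : Fin n × ℕ) : ℕ := (v.2 + (∑ i, a i - a v.1)) * n + v.1

theorem boxKey_injective (a : Fin n → ℕ) : Function.Injective (boxKey a) := by
  rintro ⟨i, j⟩ ⟨i', j'⟩ h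
  simp only [boxKey] at h
  have hi : (i : ℕ) = i' := by
    have h1 := congrArg (· % n) h
    simpa [Nat.mul_add_mod', Nat.mod_eq_of_lt] using h1
  obtain rfl := Fin.ext hi
  have hn : 0 < n := i.pos
  have := Nat.eq_of_mul_eq_mul_right hn (Nat.add_right_cancel h)
  simpa using this

theorem boxKey_add (a : Fin n → ℕ) (i : Fin n) (j e : ℕ) :
    boxKey a (i, j + e) = boxKey a (i, j) + e * n := by
  simp only [boxKey]; ring

theorem boxKey_lt_iff (a : Fin n → ℕ) (i : Fin n) (j : ℕ) :
    boxKey a (i, j) < (∑ i, a i) * n ↔ j < a i := by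
  have h : a i ≤ ∑ i, a i :=
    Finset.single_le_sum (f := a) (fun _ _ => Nat.zero_le _) (Finset.mem_univ i)
  have hi := i.2
  simp only [boxKey]
  constructor
  · intro h1
    by_contra! h2
    have : (∑ i, a i) * n ≤ (j + (∑ i, a i - a i)) * n := Nat.mul_le_mul_right _ (by omega)
    omega
  · intro h1
    have : (j + (∑ i, a i - a i) + 1) * n ≤ (∑ i, a i) * n := Nat.mul_le_mul_right _ (by omega)
    rw [add_mul, one_mul] at this
    omega

open Filter in
/-- A finite set of lattice elements whose shifts generate the lattice in every box at once. -/
theorem exists_finset_generating_boxes (Λ : AddSubgroup (ExpVec n)) (hΛ : ShiftStable Λ) :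
    ∃ G : Finset (ExpVec n), (∀ g ∈ G, g ∈ Λ) ∧ ∀ (a : Fin n → ℕ), ∀ f ∈ Λ, InBox a f →
      f ∈ AddSubgroup.closure {h | (∃ g ∈ G, ∃ e, h = expShift e g) ∧ InBox a h} := by
  classical
  by_contra! hcon
  have hcon' : ∀ s : Finset Λ, ∃ a : Fin n → ℕ, ∃ f ∈ Λ, InBox a f ∧
      f ∉ AddSubgroup.closure
        {h | (∃ g ∈ s.map (Function.Embedding.subtype _), ∃ e, h = expShift e g) ∧ InBox a h} := by
    intro s
    obtain ⟨a, f, h⟩ := hcon (s.map (Function.Embedding.subtype _)) (by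
      intro g hg
      obtain ⟨x, -, rfl⟩ := Finset.mem_map.1 hg
      exact x.2)
    exact ⟨a, f, h⟩
  choose a f hf hbox hnot using hcon'
  let U : Ultrafilter (Finset Λ) := Ultrafilter.of atTop
  have hU : (U : Filter (Finset Λ)) ≤ atTop := Ultrafilter.of_le atTop
  let le : Fin n × ℕ → Fin n × ℕ → Prop := fun m m' => ∀ᶠ s in U, boxKey (a s) m ≤ boxKey (a s) m'
  let I : Fin n × ℕ → Submodule ℤ ℤ := fun m =>
    { carrier := {z | ∃ h ∈ Λ, h m = z ∧ ∀ m', h m' ≠ 0 → le m' m}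
      zero_mem' := ⟨0, Λ.zero_mem, rfl, by simp⟩
      add_mem' := by
        rintro _ _ ⟨h, hh, rfl, h1⟩ ⟨h', hh', rfl, h2⟩
        refine ⟨h + h', Λ.add_mem hh hh', rfl, fun m' hm' => ?_⟩
        by_cases h0 : h m' = 0
        · exact h2 m' (by intro h0'; simp [h0, h0'] at hm')
        · exact h1 m' h0
      smul_mem' := by
        rintro z _ ⟨h, hh, rfl, h1⟩
        refine ⟨z • h, Λ.zsmul_mem hh z, rfl, fun m' hm' => h1 m' ?_⟩
        rintro h0
        simp [h0] at hm' }
  have hmono : ∀ i, Monotone fun j => I (i, j) := by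
    intro i
    refine monotone_nat_of_le_succ fun j => ?_
    rintro _ ⟨h, hh, rfl, h1⟩
    refine ⟨expShift 1 h, hΛ h hh 1, expShift_apply_add 1 h i j, ?_⟩
    rintro ⟨i', j'⟩ hm'
    rw [expShift_apply] at hm'
    split_ifs at hm' with hj
    · obtain ⟨k, rfl⟩ := Nat.exists_eq_add_of_le' hj
      rw [Nat.add_sub_cancel] at hm'
      filter_upwards [h1 _ hm'] with s hs
      rw [boxKey_add, boxKey_add]
      omega
    · exact absurd rfl hm'
  have hstab : ∀ i, ∃ N, ∀ j, N ≤ j → I (i, N) = I (i, j) := fun i =>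
    monotone_stabilizes_iff_noetherian.2 inferInstance ⟨fun j => I (i, j), hmono i⟩
  choose Ni hNi using hstab
  let c : Fin n × ℕ → ℤ := fun m => |Submodule.IsPrincipal.generator (I m)|
  have hcI : ∀ m z, z ∈ I m ↔ c m ∣ z := by
    intro m z
    rw [abs_dvd]
    rw [Submodule.IsPrincipal.mem_iff_eq_smul_generator]
    simp only [smul_eq_mul]
    constructor
    · rintro ⟨y, rfl⟩; exact dvd_mul_left _ _
    · rintro ⟨y, rfl⟩; exact ⟨y, mul_comm _ _⟩
  have hg : ∀ m, ∃ h ∈ Λ, h m = c m ∧ ∀ m', h m' ≠ 0 → le m' m := fun m => (hcI m (c m)).2 dvd_rfl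
  choose g hgΛ hgm hgle using hg
  let D : Finset (Fin n × ℕ) := Finset.univ.biUnion fun i =>
    (Finset.range (Ni i + 1)).image fun j => (i, j)
  have hD : ∀ i j, j ≤ Ni i → (i, j) ∈ D := by
    intro i j hj
    simp only [D, Finset.mem_biUnion, Finset.mem_univ, Finset.mem_image, Finset.mem_range, true_and]
    exact ⟨i, j, by omega, rfl⟩
  have hev1 : ∀ᶠ s in U, D.image (fun m => (⟨g m, hgΛ m⟩ : Λ)) ≤ s :=
    hU (eventually_ge_atTop _)
  have hev2 : ∀ᶠ s in (U : Filter (Finset Λ)), ∀ m ∈ D, ∀ m' ∈ (g m).support,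
      boxKey (a s) m' ≤ boxKey (a s) m := by
    simp only [Filter.eventually_all_finset]
    intro m _ m' hm'
    exact hgle m m' (Finsupp.mem_support_iff.1 hm')
  obtain ⟨s, hs1, hs2⟩ := (hev1.and hev2).exists
  set T := AddSubgroup.closure
        {h | (∃ g ∈ s.map (Function.Embedding.subtype _), ∃ e, h = expShift e g) ∧ InBox (a s) h}
    with hT
  have hTΛ : T ≤ Λ := by
    rw [hT, AddSubgroup.closure_le]
    rintro _ ⟨⟨h, hh, e, rfl⟩, -⟩
    obtain ⟨x, -, rfl⟩ := Finset.mem_map.1 hh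
    exact hΛ _ x.2 e
  obtain ⟨r, hr1, -, hr3⟩ := exists_reduced (boxKey (a s)) (boxKey_injective _) c
    (fun m => abs_nonneg _) T ((∑ i, a s i) * n) (by
      rintro ⟨i, j⟩ hlt -
      obtain ⟨j0, e, hj0, rfl, hc⟩ : ∃ j0 e, j0 ≤ Ni i ∧ j = j0 + e ∧ c (i, j0) = c (i, j) := by
        rcases le_total j (Ni i) with h | h
        · exact ⟨j, 0, h, rfl, rfl⟩
        · refine ⟨Ni i, j - Ni i, le_rfl, by omega, ?_⟩
          simp only [c]
          rw [hNi i j h]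
      have hsupp : ∀ m', expShift e (g (i, j0)) m' ≠ 0 →
          boxKey (a s) m' ≤ boxKey (a s) (i, j0 + e) := by
        rintro ⟨i', j'⟩ hm'
        rw [expShift_apply] at hm'
        split_ifs at hm' with hj
        · obtain ⟨k, rfl⟩ := Nat.exists_eq_add_of_le' hj
          rw [Nat.add_sub_cancel] at hm'
          have := hs2 _ (hD i j0 hj0) _ (Finsupp.mem_support_iff.2 hm')
          rw [boxKey_add, boxKey_add]
          omega
        · exact absurd rfl hm'
      refine ⟨expShift e (g (i, j0)),
          AddSubgroup.subset_closure ⟨⟨g (i, j0), ?_, e, rfl⟩, ?_⟩, ?_, hsupp⟩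
      · refine Finset.mem_map.2 ⟨⟨g (i, j0), hgΛ _⟩, hs1 ?_, rfl⟩
        exact Finset.mem_image_of_mem _ (hD i j0 hj0)
      · intro i' j' h'
        by_contra h0
        have := (boxKey_lt_iff (a s) i' j').1 ((hsupp _ h0).trans_lt hlt)
        omega
      · rw [expShift_apply_add, hgm, hc]) _ le_rfl (f s) (by
      rintro ⟨i, j⟩ h0
      rw [boxKey_lt_iff]
      by_contra! h1
      exact h0 (hbox s i j h1))
  have hrΛ : r ∈ Λ := by
    have := Λ.sub_mem (hf s) (hTΛ hr1)
    simpa using this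
  have hr0 : r = 0 := by
    by_contra hne
    obtain ⟨m, hm, hmax⟩ := U.exists_eventually_max r.support (Finsupp.support_nonempty_iff.2 hne)
      (fun s => boxKey (a s))
    have hdvd : c m ∣ r m := by
      rw [← hcI]
      refine ⟨r, hrΛ, rfl, fun m' hm' => ?_⟩
      filter_upwards [hmax] with s hs
      exact hs m' (Finsupp.mem_support_iff.2 hm')
    rw [Finsupp.mem_support_iff] at hm
    have hc0 : c m ≠ 0 := by
      intro h0
      rw [h0, zero_dvd_iff] at hdvd
      exact hm hdvd
    obtain ⟨h1, h2⟩ := hr3 m hc0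
    have := Int.le_of_dvd (by omega) hdvd
    omega
  rw [hr0, sub_zero] at hr1
  exact hnot s hr1

/-- Outside the box `a`, the vector `f` is nonzero, nonnegative and supported on `Z`. -/
def Escapes (Z : Set (Fin n)) (a : Fin n → ℕ) (f : ExpVec n) : Prop :=
  (∀ i j, a i ≤ j → f (i, j) ≠ 0 → 0 < f (i, j) ∧ i ∈ Z) ∧ ¬ InBox a f

/-- The part of `h` on or beyond the boundary of the box `a` is the boundary vector `C`. -/
def HasBoundary (a : Fin n → ℕ) (h : ExpVec n) (C : Fin n → ℤ) : Prop :=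
  (∀ i j, a i < j → h (i, j) = 0) ∧ ∀ i, h (i, a i) = C i

open Filter in
theorem exists_eventually_hasBoundary {α : Type*} (U : Ultrafilter α) (a : α → Fin n → ℕ)
    (g : ExpVec n) (hg : g ≠ 0) (hlarge : ∀ i j, g (i, j) ≠ 0 → ∀ N, ∀ᶠ s in U, N ≤ a s i) :
    ∃ p : Fin n × ℕ, g p ≠ 0 ∧ ∃ τ : Fin n → ℤ,
      (∀ᶠ s in U, p.2 ≤ a s p.1 ∧ HasBoundary (a s) (expShift (a s p.1 - p.2) g) τ) ∧
      ∀ i, τ i ≠ 0 → ∃ d : ℤ, ∀ᶠ s in U, (a s i : ℤ) - a s p.1 = d := by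
  classical
  obtain ⟨p, hp, hmax⟩ := U.exists_eventually_max g.support (Finsupp.support_nonempty_iff.2 hg)
    (fun s m => (m.2 : ℤ) - a s m.1)
  have hp0 := Finsupp.mem_support_iff.1 hp
  have hpa := hlarge p.1 p.2 hp0 p.2
  have hτ : ∀ i, ∃ t ∈ insert 0 (g.support.image g), ∀ᶠ s in U,
      expShift (a s p.1 - p.2) g (i, a s i) = t := by
    intro i
    refine U.exists_eventually_of_finite _
      (fun t s => expShift (a s p.1 - p.2) g (i, a s i) = t) (.of_forall fun s => ?_)
    refine ⟨_, ?_, rfl⟩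
    rw [expShift_apply]
    split_ifs with h
    · by_cases h0 : g (i, a s i - (a s p.1 - p.2)) = 0
      · rw [h0]; exact Finset.mem_insert_self _ _
      · exact Finset.mem_insert_of_mem (Finset.mem_image_of_mem _ (Finsupp.mem_support_iff.2 h0))
    · exact Finset.mem_insert_self _ _
  choose τ hτ' hτ using hτ
  have hall := Filter.eventually_all.2 hτ
  refine ⟨p, hp0, τ, ?_, ?_⟩
  · filter_upwards [hpa, hmax, hall] with s h1 h2 h3
    refine ⟨h1, fun i j hj => ?_, h3⟩
    rw [expShift_apply]
    split_ifs with h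
    · by_contra h0
      have := h2 _ (Finsupp.mem_support_iff.2 h0)
      simp only at this
      omega
    · rfl
  · intro i hi
    obtain ⟨m, hm, hmev⟩ := U.exists_eventually_of_finite g.support
      (fun m s => m.1 = i ∧ m.2 + (a s p.1 - p.2) = a s i) (by
        filter_upwards [hall] with s h3
        have h4 := h3 i
        rw [expShift_apply] at h4
        split_ifs at h4 with h
        · exact ⟨_, Finsupp.mem_support_iff.2 (h4.trans_ne hi), rfl, by simp only; omega⟩
        · exact absurd h4.symm hi)
    refine ⟨m.2 - p.2, ?_⟩
    filter_upwards [hmev, hpa] with s h1 h2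
    omega

/-- The boundary coefficients of a generated vector are generated by those of the generators. -/
theorem boundary_mem_closure (a : Fin n → ℕ) (G : Set (ExpVec n)) (W : Set (Fin n → ℤ)) (d : ℕ)
    (hG : ∀ g ∈ G, g ≠ 0 → ∃ p : Fin n × ℕ, g p ≠ 0 ∧ p.2 ≤ a p.1 ∧
      ∃ τ ∈ W, HasBoundary a (expShift (a p.1 - p.2) g) τ) (v : ExpVec n)
    (hv : v ∈ AddSubgroup.closure
      {h | (∃ g ∈ G, ∃ e, h = expShift e g) ∧ InBox (fun i => a i + d + 1) h}) :
    (fun i => v (i, a i + d)) ∈ AddSubgroup.closure W := by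
  induction hv using AddSubgroup.closure_induction with
  | zero => exact zero_mem _
  | add x y _ _ hx hy => exact add_mem hx hy
  | neg x _ hx => exact neg_mem hx
  | mem h hh =>
    obtain ⟨⟨g, hg, e, rfl⟩, hbox⟩ := hh
    by_cases hg0 : g = 0
    · subst hg0
      simp only [map_zero]
      exact zero_mem _
    obtain ⟨p, hp, hpa, τ, hτ, htop⟩ := hG g hg hg0
    have he : e ≤ a p.1 - p.2 + d := by
      by_contra! h
      apply hp
      rw [← hbox p.1 (p.2 + e) (by beta_reduce; omega), expShift_apply_add]
    rcases he.eq_or_lt with rfl | he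
    · refine AddSubgroup.subset_closure ?_
      convert hτ using 1
      funext i
      rw [← htop.2 i, add_comm (a p.1 - p.2) d, ← expShift_expShift, expShift_apply_add]
    · convert zero_mem (AddSubgroup.closure W) using 1
      funext i
      rw [expShift_apply]
      split_ifs with h
      · have := htop.1 i (a i + d - e + (a p.1 - p.2)) (by omega)
        rwa [expShift_apply_add] at this
      · rfl

theorem exists_outer_layer {a : Fin n → ℕ} {v : ExpVec n} (hv : ¬ InBox a v) :
    ∃ d, InBox (fun i => a i + d + 1) v ∧ ∃ i, v (i, a i + d) ≠ 0 := by
  classical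
  simp only [InBox, not_forall] at hv
  obtain ⟨i, j, hj, h0⟩ := hv
  have hne : (v.support.filter fun m => a m.1 ≤ m.2).Nonempty :=
    ⟨(i, j), Finset.mem_filter.2 ⟨Finsupp.mem_support_iff.2 h0, hj⟩⟩
  obtain ⟨m, hm, hmax⟩ := Finset.exists_max_image _ (fun m : Fin n × ℕ => m.2 - a m.1) hne
  obtain ⟨hm1, hm2⟩ := Finset.mem_filter.1 hm
  refine ⟨m.2 - a m.1, fun i' j' h' => ?_, m.1, ?_⟩
  · beta_reduce at h'
    by_contra h0'
    have := hmax (i', j') (Finset.mem_filter.2 ⟨Finsupp.mem_support_iff.2 h0', by simp only; omega⟩)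
    simp only at this
    omega
  · rw [Nat.add_sub_cancel' hm2]
    exact Finsupp.mem_support_iff.1 hm1

open Filter in
theorem exists_eventually_escapes {α : Type*} (U : Ultrafilter α) (a : α → Fin n → ℕ)
    (Z F : Set (Fin n)) (hF : ∀ i ∉ F, ∀ N, ∀ᶠ s in U, N ≤ a s i)
    (Λ : AddSubgroup (ExpVec n)) (hΛ : ShiftStable Λ)
    (hΛF : ∀ f ∈ Λ, ∀ i ∈ F, ∀ j, f (i, j) = 0)
    (hesc : ∀ᶠ s in U, ∃ v ∈ Λ, Escapes Z (a s) v) :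
    ∃ u ∈ Λ, ∀ᶠ s in U, ∃ e, Escapes Z (a s) (expShift e u) := by
  classical
  obtain ⟨G, hGΛ, hG⟩ := exists_finset_generating_boxes Λ hΛ
  have key : ∀ g : {g // g ∈ Λ ∧ g ≠ 0}, ∃ p : Fin n × ℕ, g.1 p ≠ 0 ∧ ∃ τ : Fin n → ℤ,
      (∀ᶠ s in U, p.2 ≤ a s p.1 ∧ HasBoundary (a s) (expShift (a s p.1 - p.2) g.1) τ) ∧
      ∀ i, τ i ≠ 0 → ∃ d : ℤ, ∀ᶠ s in U, (a s i : ℤ) - a s p.1 = d := by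
    rintro ⟨g, hg, hg0⟩
    refine exists_eventually_hasBoundary U a g hg0 fun i j hij =>
      hF i fun hi => hij (hΛF g hg i hi j)
  choose p hp τ hτ hcl using key
  have hall : ∀ᶠ s in (U : Filter α), ∀ g ∈ G, ∀ (h : g ∈ Λ ∧ g ≠ 0),
      (p ⟨g, h⟩).2 ≤ a s (p ⟨g, h⟩).1 ∧
      HasBoundary (a s) (expShift (a s (p ⟨g, h⟩).1 - (p ⟨g, h⟩).2) g) (τ ⟨g, h⟩) := by
    rw [Filter.eventually_all_finset]
    intro g hg
    rw [Filter.eventually_all]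
    exact fun h => hτ ⟨g, h⟩
  obtain ⟨C, hC, hCpos, i0, hi0⟩ : ∃ C ∈ AddSubgroup.closure (Set.range τ),
      (∀ i, C i ≠ 0 → 0 < C i ∧ i ∈ Z) ∧ ∃ i0, C i0 ≠ 0 := by
    obtain ⟨s, ⟨v, hv, hvpos, hvbox⟩, hs⟩ := (hesc.and hall).exists
    obtain ⟨d, hd, i, hi⟩ := exists_outer_layer hvbox
    refine ⟨fun i => v (i, a s i + d), ?_, fun i h => hvpos i _ (by omega) h, i, hi⟩
    refine boundary_mem_closure (a s) G _ d (fun g hg hg0 => ?_) v (hG _ v hv hd)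
    have h : g ∈ Λ ∧ g ≠ 0 := ⟨hGΛ g hg, hg0⟩
    exact ⟨p ⟨g, h⟩, hp ⟨g, h⟩, (hs g hg h).1, τ ⟨g, h⟩, ⟨_, rfl⟩, (hs g hg h).2⟩
  have hi0F : i0 ∉ F := by
    intro hF0
    apply hi0
    clear hCpos hi0
    induction hC using AddSubgroup.closure_induction with
    | zero => rfl
    | add x y _ _ hx hy => simp [hx, hy]
    | neg x _ hx => simp [hx]
    | mem C hC =>
      obtain ⟨g, rfl⟩ := hC
      obtain ⟨s, -, hs⟩ := (hτ g).exists
      rw [← hs.2 i0]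
      exact hΛF _ (hΛ _ g.2.1 _) i0 hF0 _
  have hbig := hF i0 hi0F
  let cl : Fin n → Prop := fun i => ∃ d : ℤ, ∀ᶠ s in U, (a s i : ℤ) - a s i0 = d
  have hreal : ∀ C ∈ AddSubgroup.closure (Set.range τ), ∃ u ∈ Λ, ∃ M : ℕ, ∀ᶠ s in U,
      HasBoundary (a s) (expShift (a s i0 - M) u) (fun i => if cl i then C i else 0) := by
    intro C hC
    induction hC using AddSubgroup.closure_induction with
    | zero => exact ⟨0, Λ.zero_mem, 0, .of_forall fun s => by simp [HasBoundary]⟩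
    | add x y _ _ hx hy =>
      obtain ⟨u, hu, M, h⟩ := hx
      obtain ⟨u', hu', M', h'⟩ := hy
      refine ⟨expShift M' u + expShift M u', Λ.add_mem (hΛ _ hu _) (hΛ _ hu' _), M + M', ?_⟩
      filter_upwards [h, h', hbig (M + M')] with s h h' hs
      rw [map_add, expShift_expShift, expShift_expShift,
        show a s i0 - (M + M') + M' = a s i0 - M by omega,
        show a s i0 - (M + M') + M = a s i0 - M' by omega]
      refine ⟨fun i j hij => ?_, fun i => ?_⟩
      · rw [Finsupp.add_apply, h.1 i j hij, h'.1 i j hij, add_zero]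
      · rw [Finsupp.add_apply, h.2 i, h'.2 i]
        beta_reduce
        split_ifs <;> simp
    | neg x _ hx =>
      obtain ⟨u, hu, M, h⟩ := hx
      refine ⟨-u, Λ.neg_mem hu, M, ?_⟩
      filter_upwards [h] with s h
      rw [map_neg]
      refine ⟨fun i j hij => ?_, fun i => ?_⟩
      · rw [Finsupp.neg_apply, h.1 i j hij, neg_zero]
      · rw [Finsupp.neg_apply, h.2 i]
        beta_reduce
        split_ifs <;> simp
    | mem C hC =>
      obtain ⟨g, rfl⟩ := hC
      by_cases hex : ∃ i1, τ g i1 ≠ 0 ∧ cl i1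
      · obtain ⟨i1, hi1, d1, hd1⟩ := hex
        obtain ⟨d2, hd2⟩ := hcl g i1 hi1
        set q := p g with hq
        refine ⟨expShift ((d1 - d2).natAbs + q.2 + (d1 - d2) - q.2).toNat g.1, hΛ _ g.2.1 _,
          (d1 - d2).natAbs + q.2, ?_⟩
        filter_upwards [hτ g, hd1, hd2, hbig ((d1 - d2).natAbs + q.2)] with s h1 h2 h3 h4
        rw [expShift_expShift]
        have he : a s i0 - ((d1 - d2).natAbs + q.2) +
          ((d1 - d2).natAbs + q.2 + (d1 - d2) - q.2).toNat = a s q.1 - q.2 := by omega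
        rw [he]
        refine ⟨h1.2.1, fun i => ?_⟩
        rw [h1.2.2 i]
        beta_reduce
        split_ifs with hc
        · rfl
        · by_contra h0
          obtain ⟨d3, hd3⟩ := hcl g i h0
          refine hc ⟨d3 - d2 + d1, ?_⟩
          filter_upwards [hd1, hd2, hd3] with s h1 h2 h3
          rw [← hq] at h3
          omega
      · push Not at hex
        refine ⟨0, Λ.zero_mem, 0, .of_forall fun s => ?_⟩
        rw [map_zero]
        refine ⟨fun _ _ _ => rfl, fun i => ?_⟩
        beta_reduce
        split_ifs with hc
        · by_contra h0
          exact hex i (fun h => h0 h.symm) hc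
        · rfl
  obtain ⟨u, hu, M, h⟩ := hreal C hC
  refine ⟨u, hu, ?_⟩
  filter_upwards [h] with s h
  refine ⟨a s i0 - M, fun i j hij h0 => ?_, fun hbox => ?_⟩
  · rcases hij.eq_or_lt with rfl | hlt
    · rw [h.2 i] at h0 ⊢
      beta_reduce at h0 ⊢
      split_ifs at h0 ⊢ with hc
      · exact hCpos i h0
      · exact absurd rfl h0
    · exact absurd (h.1 i j hlt) h0
  · have := hbox i0 _ le_rfl
    rw [h.2 i0] at this
    beta_reduce at this
    rw [if_pos ⟨0, .of_forall fun s => sub_self _⟩] at this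
    exact hi0 this
open Filter in
theorem exists_finset_detecting_escape (Λ : AddSubgroup (ExpVec n)) (hΛ : ShiftStable Λ)
    (Z : Set (Fin n)) :
    ∃ G : Finset (ExpVec n), (∀ g ∈ G, g ∈ Λ) ∧ ∃ N : ℕ, ∀ a : Fin n → ℕ, (∀ i ∉ Z, N ≤ a i) →
      (∃ f ∈ Λ, Escapes Z a f) → ∃ g ∈ G, ∃ e, Escapes Z a (expShift e g) := by
  classical
  by_contra! hcon
  have hcon' : ∀ s : Finset Λ × ℕ, ∃ a : Fin n → ℕ, ∃ f ∈ Λ, (∀ i ∉ Z, s.2 ≤ a i) ∧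
      Escapes Z a f ∧ ∀ g ∈ s.1, ∀ e, ¬ Escapes Z a (expShift e g) := fun s => by
    obtain ⟨a, ha, ⟨f, hf, hfe⟩, hg⟩ := hcon (s.1.image Subtype.val) (by simp +contextual) s.2
    exact ⟨a, f, hf, ha, hfe, fun g hgs => hg _ (Finset.mem_image_of_mem _ hgs)⟩
  choose a f hfΛ haZ hfe hnot using hcon'
  let U : Ultrafilter (Finset Λ × ℕ) := Ultrafilter.of atTop
  have hU : (U : Filter (Finset Λ × ℕ)) ≤ atTop := Ultrafilter.of_le _
  have hnot' : ∀ g ∈ Λ, ∀ᶠ s in (U : Filter (Finset Λ × ℕ)),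
      ∀ e, ¬ Escapes Z (a s) (expShift e g) := by
    intro g hg
    filter_upwards [hU (eventually_ge_atTop (({⟨g, hg⟩}, 0) : Finset Λ × ℕ))] with s hs
    exact hnot s ⟨g, hg⟩ (hs.1 (Finset.mem_singleton_self _))
  let F : Set (Fin n) := {i | ∃ m, ∀ᶠ s in (U : Filter (Finset Λ × ℕ)), a s i = m}
  have hF : ∀ i ∉ F, ∀ N, ∀ᶠ s in (U : Filter (Finset Λ × ℕ)), N ≤ a s i := by
    intro i hi N
    by_contra hN
    rw [← Ultrafilter.eventually_not] at hN
    obtain ⟨m, -, hm⟩ := U.exists_eventually_of_finite (Finset.range N) (fun m s => a s i = m) (by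
      filter_upwards [hN] with s hs
      exact ⟨_, Finset.mem_range.2 (not_le.1 hs), rfl⟩)
    exact hi ⟨m, hm⟩
  have hFZ : ∀ i ∈ F, i ∈ Z := by
    rintro i ⟨m, hm⟩
    by_contra hi
    obtain ⟨s, hs, hs'⟩ := (hm.and (hU (eventually_ge_atTop ((∅, m + 1) : Finset Λ × ℕ)))).exists
    have h1 := haZ s i hi
    have h2 : m + 1 ≤ s.2 := hs'.2
    omega
  have hα : ∀ i, ∃ m, i ∈ F → ∀ᶠ s in (U : Filter (Finset Λ × ℕ)), a s i = m := by
    intro i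
    by_cases hi : i ∈ F
    · obtain ⟨m, hm⟩ := hi
      exact ⟨m, fun _ => hm⟩
    · exact ⟨0, fun h => absurd h hi⟩
  choose α hα using hα
  have hαall : ∀ᶠ s in (U : Filter (Finset Λ × ℕ)), ∀ i ∈ F, a s i = α i := by
    rw [eventually_all]
    intro i
    by_cases hi : i ∈ F
    · filter_upwards [hα i hi] with s hs _ using hs
    · exact .of_forall fun s h => absurd h hi
  -- Vectors of the lattice escaping in the bounded directions `F` are excluded.
  have hzero : ∀ u ∈ Λ, (∀ i ∈ F, ∀ j, α i ≤ j → u (i, j) ≠ 0 → 0 < u (i, j)) →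
      ∀ i ∈ F, ∀ j, α i ≤ j → u (i, j) = 0 := by
    intro u hu hpos i hi j hj
    by_contra h0
    have hbig : ∀ᶠ s in (U : Filter (Finset Λ × ℕ)), ∀ m ∈ u.support, m.1 ∉ F → m.2 < a s m.1 := by
      rw [eventually_all_finset]
      intro m _
      by_cases hm : m.1 ∈ F
      · exact .of_forall fun s h => absurd hm h
      · filter_upwards [hF _ hm (m.2 + 1)] with s hs _ using hs
    obtain ⟨s, h1, h2, h3⟩ := (hbig.and (hαall.and (hnot' u hu))).exists
    refine h3 0 ⟨fun i' j' hij h0' => ?_, fun hbox => ?_⟩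
    · rw [expShift_zero] at h0' ⊢
      have hi' : i' ∈ F := by
        by_contra hi'
        exact absurd (h1 (i', j') (Finsupp.mem_support_iff.2 h0') hi') (not_lt.2 hij)
      exact ⟨hpos i' hi' j' (h2 i' hi' ▸ hij) h0', hFZ i' hi'⟩
    · have := hbox i j (by rw [h2 i hi]; exact hj)
      rw [expShift_zero] at this
      exact h0 this
  let A := ∑ i, α i
  have hA : ∀ i, α i ≤ A := fun i =>
    Finset.single_le_sum (f := α) (fun _ _ => Nat.zero_le _) (Finset.mem_univ i)
  let φ : ExpVec n →+ (Fin n × Fin A → ℤ) :=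
    { toFun := fun h q => if q.1 ∈ F then h (q.1, q.2) else 0
      map_zero' := by funext q; simp
      map_add' := fun x y => by
        funext q
        simp only [Finsupp.add_apply, Pi.add_apply]
        split_ifs <;> simp }
  let T : ℕ →o AddSubgroup (ExpVec n) :=
    { toFun := fun N =>
        { carrier := {h | h ∈ Λ ∧ (∀ i ∈ F, ∀ j, α i ≤ j → h (i, j) = 0) ∧
            ∀ i ∉ F, ∀ j, N ≤ j → h (i, j) = 0}
          zero_mem' := ⟨Λ.zero_mem, fun _ _ _ _ => rfl, fun _ _ _ _ => rfl⟩
          add_mem' := fun {x y} hx hy => ⟨Λ.add_mem hx.1 hy.1,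
            fun i hi j hj => by
              rw [Finsupp.add_apply, hx.2.1 i hi j hj, hy.2.1 i hi j hj, add_zero],
            fun i hi j hj => by
              rw [Finsupp.add_apply, hx.2.2 i hi j hj, hy.2.2 i hi j hj, add_zero]⟩
          neg_mem' := fun {x} hx => ⟨Λ.neg_mem hx.1,
            fun i hi j hj => by rw [Finsupp.neg_apply, hx.2.1 i hi j hj, neg_zero],
            fun i hi j hj => by rw [Finsupp.neg_apply, hx.2.2 i hi j hj, neg_zero]⟩ }
      monotone' := fun N N' hN h hh =>
        ⟨hh.1, hh.2.1, fun i hi j hj => hh.2.2 i hi j (hN.trans hj)⟩ }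
  have memT : ∀ N h, h ∈ T N ↔ h ∈ Λ ∧ (∀ i ∈ F, ∀ j, α i ≤ j → h (i, j) = 0) ∧
      ∀ i ∉ F, ∀ j, N ≤ j → h (i, j) = 0 := fun _ _ => Iff.rfl
  let P : ℕ →o Submodule ℤ (Fin n × Fin A → ℤ) :=
    { toFun := fun N => AddSubgroup.toIntSubmodule ((T N).map φ)
      monotone' := fun N N' hN =>
        AddSubgroup.toIntSubmodule.monotone (AddSubgroup.map_mono (T.monotone hN)) }
  have memP : ∀ N q, q ∈ P N ↔ ∃ h ∈ T N, φ h = q := fun _ _ => Iff.rfl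
  obtain ⟨N0, hN0⟩ := monotone_stabilizes_iff_noetherian.2
    (inferInstance : IsNoetherian ℤ (Fin n × Fin A → ℤ)) P
  let Λ' : AddSubgroup (ExpVec n) :=
    { carrier := {u | u ∈ Λ ∧ ∀ i ∈ F, ∀ j, u (i, j) = 0}
      zero_mem' := ⟨Λ.zero_mem, fun _ _ _ => rfl⟩
      add_mem' := fun {x y} hx hy => ⟨Λ.add_mem hx.1 hy.1,
        fun i hi j => by rw [Finsupp.add_apply, hx.2 i hi, hy.2 i hi, add_zero]⟩
      neg_mem' := fun {x} hx => ⟨Λ.neg_mem hx.1,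
        fun i hi j => by rw [Finsupp.neg_apply, hx.2 i hi, neg_zero]⟩ }
  have memΛ' : ∀ u, u ∈ Λ' ↔ u ∈ Λ ∧ ∀ i ∈ F, ∀ j, u (i, j) = 0 := fun _ => Iff.rfl
  have hlarge : ∀ᶠ s in (U : Filter (Finset Λ × ℕ)), ∀ i, i ∉ F → N0 ≤ a s i := by
    rw [eventually_all]
    intro i
    by_cases hi : i ∈ F
    · exact .of_forall fun s h => absurd hi h
    · filter_upwards [hF i hi N0] with s hs _ using hs
  obtain ⟨u, hu, hesc⟩ := exists_eventually_escapes U a Z F hF Λ'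
    (fun v hv e => (memΛ' _).2 ⟨hΛ _ hv.1 e, fun i hi j => by
      rw [expShift_apply]
      split_ifs
      · exact hv.2 i hi _
      · rfl⟩)
    (fun v hv => hv.2) (by
      filter_upwards [hαall, hlarge] with s h1 h2
      have hfF := hzero (f s) (hfΛ s) fun i hi j hj h0 =>
        ((hfe s).1 i j (by rw [h1 i hi]; exact hj) h0).1
      have hfT : ∃ N, f s ∈ T N := by
        refine ⟨(f s).support.sup Prod.snd + 1, (memT _ _).2 ⟨hfΛ s, hfF, fun i _ j hj => ?_⟩⟩
        by_contra h0
        have := Finset.le_sup (f := Prod.snd) (Finsupp.mem_support_iff.2 h0)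
        simp only at this
        omega
      obtain ⟨N, hN⟩ := hfT
      have hmem : φ (f s) ∈ P N0 := by
        have : φ (f s) ∈ P (max N0 N) :=
          P.monotone (le_max_right N0 N) ((memP _ _).2 ⟨_, hN, rfl⟩)
        rwa [← hN0 _ (le_max_left N0 N)] at this
      obtain ⟨h, hh, hφ⟩ := (memP _ _).1 hmem
      obtain ⟨hhΛ, hhF, hhN⟩ := (memT _ _).1 hh
      have hbox : InBox (a s) h := by
        intro i j hj
        by_cases hi : i ∈ F
        · exact hhF i hi j (by rw [← h1 i hi]; exact hj)
        · exact hhN i hi j ((h2 i hi).trans hj)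
      have hsame : ∀ i j, a s i ≤ j → (f s - h) (i, j) = f s (i, j) := fun i j hj => by
        rw [Finsupp.sub_apply, hbox i j hj, sub_zero]
      refine ⟨f s - h, (memΛ' _).2 ⟨Λ.sub_mem (hfΛ s) hhΛ, fun i hi j => ?_⟩, ?_, fun hb => ?_⟩
      · rw [Finsupp.sub_apply]
        rcases lt_or_ge j (α i) with hj | hj
        · have := congrFun hφ (i, ⟨j, hj.trans_le (hA i)⟩)
          simp only [φ, AddMonoidHom.coe_mk, ZeroHom.coe_mk, if_pos hi] at this
          rw [this, sub_self]
        · rw [hfF i hi j hj, hhF i hi j hj, sub_zero]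
      · intro i j hj h0
        rw [hsame i j hj] at h0 ⊢
        exact (hfe s).1 i j hj h0
      · exact (hfe s).2 fun i j hj => by rw [← hsame i j hj]; exact hb i j hj)
  obtain ⟨s, ⟨e, he⟩, hs⟩ := (hesc.and (hnot' u hu.1)).exists
  exact hs e he

end ExpShift

section Binomials

variable {ι : Type*} {K : Type*} [Field K]

/-- The positive part of an integer exponent vector. -/
noncomputable def posExp (f : ι →₀ ℤ) : ι →₀ ℕ := f.mapRange Int.toNat rfl

theorem posExp_apply (f : ι →₀ ℤ) (v : ι) : posExp f v = (f v).toNat := rfl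

variable (K) in
/-- The pure binomial `Y^(f⁺) - Y^(f⁻)` of an integer exponent vector `f`. -/
noncomputable def expBinomial (f : ι →₀ ℤ) : MvPolynomial ι K :=
  MvPolynomial.monomial (posExp f) 1 - MvPolynomial.monomial (posExp (-f)) 1

/-- The inclusion of natural exponent vectors into integer exponent vectors. -/
noncomputable def expCast : (ι →₀ ℕ) →+ (ι →₀ ℤ) :=
  Finsupp.mapRange.addMonoidHom (Nat.castAddMonoidHom ℤ)

theorem expCast_apply (u : ι →₀ ℕ) (v : ι) : expCast u v = (u v : ℤ) := rfl

theorem expCast_posExp_sub (f : ι →₀ ℤ) : expCast (posExp f) - expCast (posExp (-f)) = f := by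
  ext v
  simp only [Finsupp.sub_apply, expCast_apply, posExp_apply, Finsupp.neg_apply]
  omega

theorem monomial_sub_monomial (u u' : ι →₀ ℕ) :
    MvPolynomial.monomial u (1 : K) - MvPolynomial.monomial u' 1 =
      MvPolynomial.monomial (u ⊓ u') 1 * expBinomial K (expCast u - expCast u') := by
  rw [expBinomial, mul_sub, MvPolynomial.monomial_mul, MvPolynomial.monomial_mul, mul_one]
  congr 3 <;> ext v <;>
    simp only [Finsupp.add_apply, posExp_apply, Finsupp.sub_apply, Finsupp.neg_apply,
      expCast_apply, Finsupp.inf_apply] <;> omega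

/-- The ideal generated by the binomials of a lattice of exponent vectors. -/
noncomputable def expLatticeIdeal (K : Type*) [Field K] (Λ : AddSubgroup (ι →₀ ℤ)) :
    Ideal (MvPolynomial ι K) :=
  Ideal.span (expBinomial K '' Λ)

theorem monomial_sub_mem_expLatticeIdeal {Λ : AddSubgroup (ι →₀ ℤ)} {u u' : ι →₀ ℕ}
    (h : expCast u - expCast u' ∈ Λ) (c : K) :
    MvPolynomial.monomial u c - MvPolynomial.monomial u' c ∈ expLatticeIdeal K Λ := by
  have hc : ∀ t : ι →₀ ℕ,
      MvPolynomial.monomial t c = MvPolynomial.C c * MvPolynomial.monomial t 1 :=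
    fun t => by rw [MvPolynomial.C_mul_monomial, mul_one]
  rw [hc, hc, ← mul_sub, monomial_sub_monomial]
  exact Ideal.mul_mem_left _ _ (Ideal.mul_mem_left _ _ (Ideal.subset_span ⟨_, h, rfl⟩))

/-- Characters with values in an algebraically closed field of characteristic zero separate the
points of an abelian group. -/
theorem exists_character_ne_one {A E : Type*} [AddCommGroup A] [Field E] [IsAlgClosed E]
    [CharZero E] {g : A} (hg : g ≠ 0) : ∃ χ : Multiplicative A →* E, χ (.ofAdd g) ≠ 1 := by
  have hdiv : DivisibleBy (Additive Eˣ) ℕ := divisibleByOfSMulRightSurj _ _ fun {m} hm x => by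
    obtain ⟨z, hz⟩ := IsAlgClosed.exists_pow_nat_eq (x.toMul : E) (Nat.pos_of_ne_zero hm)
    have hz0 : z ≠ 0 := by
      rintro rfl
      rw [zero_pow hm] at hz
      exact x.toMul.ne_zero hz.symm
    exact ⟨.ofMul (Units.mk0 z hz0), congrArg Additive.ofMul (Units.ext hz)⟩
  have hdivZ : DivisibleBy (Additive Eˣ) ℤ := AddGroup.divisibleByIntOfDivisibleByNat _
  obtain ⟨e, he, he1⟩ : ∃ e : Eˣ, e ^ addOrderOf g = 1 ∧ e ≠ 1 := by
    rcases eq_or_ne (addOrderOf g) 0 with h0 | h0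
    · refine ⟨Units.mk0 2 two_ne_zero, by rw [h0, pow_zero], fun h => ?_⟩
      have : (2 : E) = 1 := congrArg Units.val h
      norm_num at this
    · have : NeZero ((addOrderOf g : ℕ) : E) := ⟨Nat.cast_ne_zero.2 h0⟩
      obtain ⟨ζ, hζ⟩ := HasEnoughRootsOfUnity.exists_primitiveRoot E (addOrderOf g)
      have hu := hζ.isUnit_unit h0
      refine ⟨_, hu.pow_eq_one, hu.ne_one ?_⟩
      have : addOrderOf g ≠ 1 := fun h => hg (AddMonoid.addOrderOf_eq_one_iff.1 h)
      omega
  let i : ZMod (addOrderOf g) →+ A := ZMod.lift _ ⟨zmultiplesHom A g, by simp⟩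
  have hi : Function.Injective i := (ZMod.lift_injective _).2 fun m hm => by
    rw [ZMod.intCast_zmod_eq_zero_iff_dvd]
    exact addOrderOf_dvd_iff_zsmul_eq_zero.2 (by simpa using hm)
  let ψ : ZMod (addOrderOf g) →+ Additive Eˣ := ZMod.lift _ ⟨zmultiplesHom _ (.ofMul e), by
    simpa using congrArg Additive.ofMul he⟩
  obtain ⟨χ, hχ⟩ := (Module.Baer.of_divisible (Additive Eˣ)).extension_property_addMonoidHom i hi ψ
  refine ⟨(Units.coeHom E).comp (AddMonoidHom.toMultiplicativeLeft χ), fun h => he1 ?_⟩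
  have h1 : χ g = .ofMul e := by
    have := DFunLike.congr_fun hχ ((1 : ℤ) : ZMod (addOrderOf g))
    simpa [i, ψ, ZMod.lift_coe, -Int.cast_one] using this
  have h2 : (χ g).toMul = 1 := Units.ext h
  rwa [h1] at h2

variable [CharZero K]

theorem isRadical_expLatticeIdeal (Λ : AddSubgroup (ι →₀ ℤ)) :
    (expLatticeIdeal K Λ).IsRadical := by
  classical
  rintro f ⟨k, hk⟩
  let E := AlgebraicClosure K
  let A := (ι →₀ ℤ) ⧸ Λ
  let q : (ι →₀ ℕ) →+ A := (QuotientAddGroup.mk' Λ).comp expCast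
  have hq : ∀ u u', q u = q u' ↔ expCast u - expCast u' ∈ Λ := fun u u' => by
    rw [← QuotientAddGroup.eq_zero_iff, QuotientAddGroup.mk_sub, sub_eq_zero]
    rfl
  let ev (χ : Multiplicative A →* E) : MvPolynomial ι K →+* E :=
    MvPolynomial.eval₂Hom (algebraMap K E) fun v => χ (.ofAdd (q (.single v 1)))
  have hev : ∀ χ u c, ev χ (MvPolynomial.monomial u c) = algebraMap K E c * χ (.ofAdd (q u)) := by
    intro χ u c
    rw [MvPolynomial.eval₂Hom_monomial]
    congr 1
    let χq : Multiplicative (ι →₀ ℕ) →* E := χ.comp q.toMultiplicative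
    change u.prod (fun v k => χq (.ofAdd (.single v 1)) ^ k) = χq (.ofAdd u)
    conv_rhs => rw [← u.sum_single, Finsupp.sum, ofAdd_sum, map_prod]
    refine Finset.prod_congr rfl fun v _ => ?_
    beta_reduce
    rw [← map_pow, ← ofAdd_nsmul, Finsupp.smul_single, smul_eq_mul, mul_one]
  have hker : ∀ χ, ∀ p ∈ expLatticeIdeal K Λ, ev χ p = 0 := by
    intro χ p hp
    have : expLatticeIdeal K Λ ≤ RingHom.ker (ev χ) := by
      refine Ideal.span_le.2 ?_
      rintro _ ⟨g, hg, rfl⟩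
      rw [SetLike.mem_coe, RingHom.mem_ker, expBinomial, map_sub, hev, hev,
        (hq _ _).2 (by rwa [expCast_posExp_sub]), sub_self]
    exact this hp
  let c (a : A) : K := ∑ u ∈ f.support with q u = a, f.coeff u
  have hsum : ∀ χ : Multiplicative A →* E,
      ∑ a ∈ f.support.image q, algebraMap K E (c a) * χ (.ofAdd a) = 0 := by
    intro χ
    have hf : ev χ f = 0 := eq_zero_of_pow_eq_zero (n := k) (by rw [← map_pow]; exact hker χ _ hk)
    rw [← f.support_sum_monomial_coeff, map_sum] at hf
    rw [← hf, ← Finset.sum_fiberwise_of_maps_to (fun u hu => Finset.mem_image_of_mem q hu)]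
    refine Finset.sum_congr rfl fun a _ => ?_
    rw [map_sum, Finset.sum_mul]
    refine Finset.sum_congr rfl fun u hu => ?_
    rw [hev, (Finset.mem_filter.1 hu).2]
  have hc : ∀ a ∈ f.support.image q, c a = 0 := by
    let ε (a : A) : (Multiplicative A →* E) →* E := MonoidHom.eval (.ofAdd a)
    have hε : Function.Injective ε := by
      intro a b hab
      by_contra hne
      obtain ⟨χ, hχ⟩ := exists_character_ne_one (E := E) (sub_ne_zero.2 hne)
      apply hχ
      have h1 : χ (.ofAdd a) = χ (.ofAdd b) := DFunLike.congr_fun hab χ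
      have h2 : χ (.ofAdd (a - b)) * χ (.ofAdd b) = χ (.ofAdd b) := by
        rw [← map_mul, ← ofAdd_add, sub_add_cancel, h1]
      refine mul_right_cancel₀ (fun h0 => ?_) (h2.trans (one_mul _).symm)
      have h3 := map_one χ
      rw [← ofAdd_zero, ← sub_self b, sub_eq_add_neg, ofAdd_add, map_mul, h0, zero_mul] at h3
      exact zero_ne_one h3
    have hli := linearIndependent_iff'.1
      ((linearIndependent_monoidHom (Multiplicative A →* E) E).comp ε hε) (f.support.image q)
      (fun a => algebraMap K E (c a)) (by
        funext χ
        simpa [ε, Algebra.smul_def] using hsum χ)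
    intro a ha
    simpa using hli a ha
  let r : A → (ι →₀ ℕ) := Function.invFun q
  have hr : ∀ u, q (r (q u)) = q u := fun u => Function.invFun_eq ⟨u, rfl⟩
  have hzero : ∑ u ∈ f.support, MvPolynomial.monomial (r (q u)) (f.coeff u) = 0 := by
    rw [← Finset.sum_fiberwise_of_maps_to (fun u hu => Finset.mem_image_of_mem q hu)]
    refine Finset.sum_eq_zero fun a ha => ?_
    calc _ = ∑ u ∈ f.support with q u = a, MvPolynomial.monomial (r a) (f.coeff u) :=
          Finset.sum_congr rfl fun u hu => by rw [(Finset.mem_filter.1 hu).2]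
      _ = MvPolynomial.monomial (r a) (c a) := (map_sum _ _ _).symm
      _ = 0 := by rw [hc a ha, MvPolynomial.monomial_zero]
  have hdiff : f = ∑ u ∈ f.support, (MvPolynomial.monomial u (f.coeff u) -
      MvPolynomial.monomial (r (q u)) (f.coeff u)) := by
    rw [Finset.sum_sub_distrib, hzero, sub_zero, MvPolynomial.support_sum_monomial_coeff]
  rw [hdiff]
  exact Ideal.sum_mem _ fun u _ => monomial_sub_mem_expLatticeIdeal ((hq _ _).1 (hr u).symm) _

end Binomials

section LatticeIdeal

variable {K : Type*} [Field K] {n : ℕ} (σK : K →+* K)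

theorem shift_eq_rename_map (p : DPoly K n) : shift σK p =
    MvPolynomial.rename (fun v : Fin n × ℕ => (v.1, v.2 + 1)) (MvPolynomial.map σK p) := by
  refine DFunLike.congr_fun (g := (MvPolynomial.rename (R := K)
    (fun v : Fin n × ℕ => (v.1, v.2 + 1))).toRingHom.comp (MvPolynomial.map σK))
    (MvPolynomial.ringHom_ext (fun r => ?_) fun v => ?_) p
  · simp [shift]
  · simp [shift]

theorem shift_X (v : Fin n × ℕ) :
    shift σK (MvPolynomial.X v : DPoly K n) = MvPolynomial.X (v.1, v.2 + 1) := by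
  simp [shift]

theorem mapDomain_posExp (f : ExpVec n) :
    (posExp f).mapDomain (fun v : Fin n × ℕ => (v.1, v.2 + 1)) = posExp (expShift 1 f) := by
  ext ⟨i, j⟩
  rw [posExp_apply, expShift_apply]
  split_ifs with h
  · obtain ⟨j, rfl⟩ := Nat.exists_eq_add_of_le' h
    exact Finsupp.mapDomain_apply (shiftIndex_injective 1) (posExp f) (i, j)
  · refine Finsupp.mapDomain_of_notMem_range _ _ ?_
    rintro ⟨v, hv⟩
    simp only [Prod.mk.injEq] at hv
    omega

theorem shift_expBinomial (f : ExpVec n) :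
    shift σK (expBinomial K f) = expBinomial K (expShift 1 f) := by
  simp only [shift_eq_rename_map, expBinomial, map_sub, MvPolynomial.map_monomial, map_one,
    MvPolynomial.rename_monomial, mapDomain_posExp, map_neg]

theorem expBinomial_expShift_mem {I : Ideal (DPoly K n)} (hI : IsSigmaIdeal (shift σK) I)
    {f : ExpVec n} (hf : expBinomial K f ∈ I) (e : ℕ) : expBinomial K (expShift e f) ∈ I := by
  induction e with
  | zero => rwa [expShift_zero]
  | succ e ih =>
    rw [add_comm, ← expShift_expShift, ← shift_expBinomial σK]
    exact hI _ ih

theorem iterate_shift_X (i : Fin n) (k : ℕ) :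
    (⇑(shift σK))^[k] (MvPolynomial.X (i, 0) : DPoly K n) = MvPolynomial.X (i, k) := by
  induction k with
  | zero => rfl
  | succ k ih => rw [Function.iterate_succ_apply', ih, shift_X]

theorem monom_eq_monomial_s1 (p : Fin n → Polynomial ℕ) (u : Fin n × ℕ →₀ ℕ)
    (hu : ∀ i j, u (i, j) = (p i).coeff j) : monom σK p = MvPolynomial.monomial u 1 := by
  classical
  simp only [monom, ypow, sexp, iterate_shift_X, MvPolynomial.X_pow_eq_monomial,
    ← MvPolynomial.monomial_sum_one]
  congr 2
  ext ⟨i, j⟩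
  simp only [hu, Finsupp.finsetSum_apply, Finsupp.single_apply, Prod.mk.injEq]
  rw [Finset.sum_eq_single i (fun i' _ hi => Finset.sum_eq_zero fun k _ => by simp [hi]) (by simp)]
  simp only [true_and, Finset.sum_ite_eq', Finset.mem_range]
  split_ifs with h
  · rfl
  · exact (Polynomial.coeff_eq_zero_of_natDegree_lt (by omega)).symm

/-- The exponent vector of a vector of polynomials with integer coefficients. -/
noncomputable def toExpVec (n : ℕ) : (Fin n → Polynomial ℤ) →+ ExpVec n where
  toFun f := Finsupp.ofSupportFinite (fun v => (f v.1).coeff v.2) <| by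
    classical
    refine (Finset.univ.biUnion fun i =>
      (f i).support.image fun j => (i, j)).finite_toSet.subset fun v hv => ?_
    simpa using ⟨v.1, v.2, hv, rfl⟩
  map_zero' := by ext; simp [Finsupp.ofSupportFinite_coe]
  map_add' f g := by ext; simp [Finsupp.ofSupportFinite_coe]

theorem toExpVec_apply (f : Fin n → Polynomial ℤ) (i : Fin n) (j : ℕ) :
    toExpVec n f (i, j) = (f i).coeff j := rfl

theorem coeff_posPart (f : Polynomial ℤ) (j : ℕ) : (posPart f).coeff j = (f.coeff j).toNat := by
  simp only [_root_.posPart, Polynomial.sum_def, Polynomial.finsetSum_coeff,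
    Polynomial.coeff_monomial, Finset.sum_ite_eq', Polynomial.mem_support_iff]
  split_ifs with h
  · rfl
  · simp [not_not.1 h]

theorem coeff_negPart (f : Polynomial ℤ) (j : ℕ) : (negPart f).coeff j = (-f.coeff j).toNat := by
  simp only [_root_.negPart, Polynomial.sum_def, Polynomial.finsetSum_coeff,
    Polynomial.coeff_monomial, Finset.sum_ite_eq', Polynomial.mem_support_iff]
  split_ifs with h
  · rfl
  · simp [not_not.1 h]

theorem monom_posPart_sub_monom_negPart (f : Fin n → Polynomial ℤ) :
    monom σK (fun i => posPart (f i)) - monom σK (fun i => negPart (f i)) =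
      expBinomial K (toExpVec n f) := by
  rw [expBinomial, ← monom_eq_monomial_s1 σK _ _ fun i j => ?_,
    ← monom_eq_monomial_s1 σK _ _ fun i j => ?_]
  · rw [posExp_apply, coeff_negPart, Finsupp.neg_apply, toExpVec_apply]
  · rw [posExp_apply, coeff_posPart, toExpVec_apply]

/-- The lattice of exponent vectors of a `ℤ[x]`-lattice. -/
noncomputable def expLattice (L : Submodule (Polynomial ℤ) (Fin n → Polynomial ℤ)) :
    AddSubgroup (ExpVec n) :=
  L.toAddSubgroup.map (toExpVec n)

theorem shiftStable_expLattice (L : Submodule (Polynomial ℤ) (Fin n → Polynomial ℤ)) :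
    ShiftStable (expLattice L) := by
  rintro _ ⟨f, hf, rfl⟩ e
  refine ⟨(Polynomial.X ^ e : Polynomial ℤ) • f, L.smul_mem _ hf, ?_⟩
  ext ⟨i, j⟩
  rw [toExpVec_apply, expShift_apply, Pi.smul_apply, smul_eq_mul, Polynomial.coeff_X_pow_mul']
  rfl

theorem isSigmaIdeal_expLatticeIdeal {Λ : AddSubgroup (ExpVec n)} (hΛ : ShiftStable Λ) :
    IsSigmaIdeal (shift σK) (expLatticeIdeal K Λ) := by
  have : expLatticeIdeal K Λ ≤ (expLatticeIdeal K Λ).comap (shift σK) := by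
    refine Ideal.span_le.2 ?_
    rintro _ ⟨f, hf, rfl⟩
    rw [SetLike.mem_coe, Ideal.mem_comap, shift_expBinomial]
    exact Ideal.subset_span ⟨_, hΛ f hf 1, rfl⟩
  exact fun x hx => this hx

theorem latticeIdeal_eq_expLatticeIdeal (L : Submodule (Polynomial ℤ) (Fin n → Polynomial ℤ)) :
    latticeIdeal σK L = expLatticeIdeal K (expLattice L) := by
  have hset : {p | ∃ f ∈ L, p = monom σK (fun i => posPart (f i)) -
      monom σK (fun i => negPart (f i))} = expBinomial K '' (expLattice L : Set (ExpVec n)) := by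
    ext p
    simp only [monom_posPart_sub_monom_negPart]
    constructor
    · rintro ⟨f, hf, rfl⟩
      exact ⟨_, ⟨f, hf, rfl⟩, rfl⟩
    · rintro ⟨_, ⟨f, hf, rfl⟩, rfl⟩
      exact ⟨f, hf, rfl⟩
  rw [latticeIdeal, hset, sigmaIdealGen]
  refine le_antisymm (sInf_le ⟨Ideal.subset_span, ?_⟩) (le_sInf fun I hI => Ideal.span_le.2 hI.1)
  exact isSigmaIdeal_expLatticeIdeal σK (shiftStable_expLattice L)

/-- Minimal primes over a radical well-mixed ideal are σ-ideals. -/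
theorem isSigmaIdeal_of_mem_minimalPrimes {R : Type*} [CommRing R] {σ : R →+* R} {I p : Ideal R}
    (hwm : IsWellMixed σ I) (hrad : I.IsRadical) (hp : p ∈ I.minimalPrimes) :
    IsSigmaIdeal σ p := by
  intro x hx
  have hpp := hp.isPrime
  suffices h : ∃ y ∉ p, y * x ∈ I by
    obtain ⟨y, hy, hyx⟩ := h
    exact (hpp.mem_or_mem (hp.le (hwm y x hyx))).resolve_left hy
  by_contra! hcon
  obtain ⟨q, hq, hIq, hdisj⟩ := Ideal.exists_le_prime_disjoint I
    (Submonoid.powers x ⊔ p.primeCompl) (Set.disjoint_left.2 fun z hzI hz => by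
      obtain ⟨_, ⟨k, rfl⟩, y, hy, rfl⟩ := Submonoid.mem_sup.1 hz
      refine hcon y hy (hrad ⟨k + 1, ?_⟩)
      have : (y * x) ^ (k + 1) = (y ^ k * x) * (x ^ k * y) := by ring
      rw [this]
      exact I.mul_mem_left _ hzI)
  have hqp : q ≤ p := fun z hz => by
    by_contra hzp
    exact Set.disjoint_left.1 hdisj hz (Submonoid.mem_sup_right (show z ∈ p.primeCompl from hzp))
  exact Set.disjoint_left.1 hdisj (hp.2 ⟨hq, hIq⟩ hqp hx)
    (Submonoid.mem_sup_left (Submonoid.mem_powers x))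

theorem monomial_mem_iff_of_isPrime {ι : Type*} {p : Ideal (MvPolynomial ι K)} (hp : p.IsPrime)
    (u : ι →₀ ℕ) :
    MvPolynomial.monomial u (1 : K) ∈ p ↔ ∃ v, u v ≠ 0 ∧ MvPolynomial.X v ∈ p := by
  rw [MvPolynomial.monomial_eq, MvPolynomial.C_1, one_mul, Finsupp.prod, hp.prod_mem_iff]
  simp only [Finsupp.mem_support_iff]
  refine exists_congr fun v => and_congr_right fun hv => ?_
  rw [hp.pow_mem_iff_mem _ (Nat.pos_of_ne_zero hv)]

theorem expBinomial_neg {ι : Type*} (f : ι →₀ ℤ) : expBinomial K (-f) = -expBinomial K f := by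
  rw [expBinomial, expBinomial, neg_neg, neg_sub]

theorem expBinomial_add_mem {ι : Type*} {p : Ideal (MvPolynomial ι K)} (hp : p.IsPrime)
    {f g : ι →₀ ℤ} (hf : expBinomial K f ∈ p) (hg : expBinomial K g ∈ p)
    (hX : ∀ v, MvPolynomial.X v ∈ p → f v = 0 ∧ g v = 0) : expBinomial K (f + g) ∈ p := by
  have h : MvPolynomial.monomial (posExp f + posExp g) (1 : K) -
      MvPolynomial.monomial (posExp (-f) + posExp (-g)) 1 ∈ p := by
    have : MvPolynomial.monomial (posExp f + posExp g) (1 : K) -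
        MvPolynomial.monomial (posExp (-f) + posExp (-g)) 1 =
        MvPolynomial.monomial (posExp f) 1 * expBinomial K g +
          MvPolynomial.monomial (posExp (-g)) 1 * expBinomial K f := by
      have hm : ∀ u u' : ι →₀ ℕ, MvPolynomial.monomial (u + u') (1 : K) =
          MvPolynomial.monomial u 1 * MvPolynomial.monomial u' 1 := fun u u' => by
        rw [MvPolynomial.monomial_mul, mul_one]
      rw [hm, hm, expBinomial, expBinomial]
      ring
    rw [this]
    exact p.add_mem (p.mul_mem_left _ hg) (p.mul_mem_left _ hf)
  have hcast : expCast (posExp f + posExp g) - expCast (posExp (-f) + posExp (-g)) = f + g := by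
    rw [map_add, map_add, add_sub_add_comm, expCast_posExp_sub, expCast_posExp_sub]
  rw [monomial_sub_monomial, hcast] at h
  refine (hp.mem_or_mem h).resolve_left fun hmem => ?_
  obtain ⟨v, hv, hvp⟩ := (monomial_mem_iff_of_isPrime hp _).1 hmem
  apply hv
  simp [posExp_apply, (hX v hvp).1, (hX v hvp).2]

/-- Exponent vectors escaping from the variables outside a prime ideal give binomials outside
that ideal. -/
theorem expBinomial_notMem_of_escapes {p : Ideal (DPoly K n)} (hp : p.IsPrime) {Z : Set (Fin n)}
    {a : Fin n → ℕ} (hX : ∀ i j, MvPolynomial.X (i, j) ∈ p ↔ i ∈ Z ∧ a i ≤ j) {h : ExpVec n}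
    (hh : Escapes Z a h) : expBinomial K h ∉ p := by
  intro hmem
  obtain ⟨hpos, hbox⟩ := hh
  simp only [InBox, not_forall] at hbox
  obtain ⟨i, j, hij, hne⟩ := hbox
  have hm : MvPolynomial.monomial (posExp h) (1 : K) ∈ p :=
    (monomial_mem_iff_of_isPrime hp _).2 ⟨(i, j), by
      rw [posExp_apply]; have := (hpos i j hij hne).1; omega,
      (hX i j).2 ⟨(hpos i j hij hne).2, hij⟩⟩
  obtain ⟨⟨i', j'⟩, hv, hvp⟩ := (monomial_mem_iff_of_isPrime hp _).1
    ((p.sub_mem_iff_right hm).1 hmem)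
  rw [posExp_apply, Finsupp.neg_apply] at hv
  have := (hpos i' j' ((hX i' j').1 hvp).2 (by omega)).1
  omega

/-- Finitely many binomials of a shift-stable lattice detect the prime σ-ideals containing all
of them. -/
theorem exists_finset_forall_isPrime (Λ : AddSubgroup (ExpVec n)) (hΛ : ShiftStable Λ) :
    ∃ G : Finset (ExpVec n), (∀ g ∈ G, g ∈ Λ) ∧ ∀ p : Ideal (DPoly K n), p.IsPrime →
      IsSigmaIdeal (shift σK) p → (∀ g ∈ G, expBinomial K g ∈ p) →
        ∀ f ∈ Λ, expBinomial K f ∈ p := by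
  classical
  obtain ⟨G, hG, hGbox⟩ := exists_finset_generating_boxes Λ hΛ
  choose G' hG' N hN using exists_finset_detecting_escape Λ hΛ
  refine ⟨G ∪ Finset.univ.biUnion G', fun g hg => ?_, fun p hp hσ hGp f hf => ?_⟩
  · rcases Finset.mem_union.1 hg with hg | hg
    · exact hG g hg
    · obtain ⟨Z, -, hZ⟩ := Finset.mem_biUnion.1 hg
      exact hG' Z g hZ
  let Z : Set (Fin n) := {i | ∃ j, (MvPolynomial.X (i, j) : DPoly K n) ∈ p}
  let a (i : Fin n) : ℕ :=
    if h : ∃ j, (MvPolynomial.X (i, j) : DPoly K n) ∈ p then Nat.find h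
    else max (N Z) (f.support.sup Prod.snd + 1)
  have hX : ∀ i j, (MvPolynomial.X (i, j) : DPoly K n) ∈ p ↔ i ∈ Z ∧ a i ≤ j := by
    refine fun i j => ⟨fun h => ⟨⟨j, h⟩, ?_⟩, ?_⟩
    · simp only [a, dif_pos (⟨j, h⟩ : ∃ j, (MvPolynomial.X (i, j) : DPoly K n) ∈ p)]
      exact Nat.find_min' _ h
    · rintro ⟨hi, hj⟩
      have hi' : ∃ j, (MvPolynomial.X (i, j) : DPoly K n) ∈ p := hi
      simp only [a, dif_pos hi'] at hj
      induction j, hj using Nat.le_induction with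
      | base => exact Nat.find_spec hi'
      | succ j _ ih => rw [← shift_X σK (i, j)]; exact hσ _ ih
  have ha : ∀ i ∉ Z, a i = max (N Z) (f.support.sup Prod.snd + 1) := fun i hi => dif_neg hi
  have hesc : ∀ h ∈ Λ, ¬ Escapes Z a h := by
    intro h hh hesc
    obtain ⟨g, hg, e, hge⟩ := hN Z a (fun i hi => (ha i hi).symm ▸ le_max_left _ _) ⟨h, hh, hesc⟩
    exact expBinomial_notMem_of_escapes hp hX hge (expBinomial_expShift_mem σK hσ
      (hGp g (Finset.mem_union_right _ (Finset.mem_biUnion.2 ⟨Z, Finset.mem_univ _, hg⟩))) e)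
  by_cases hbox : InBox a f
  · refine (AddSubgroup.closure_induction (p := fun h _ => InBox a h ∧ expBinomial K h ∈ p)
      ?_ ?_ ?_ ?_ (hGbox a f hf hbox)).2
    · rintro _ ⟨⟨g, hg, e, rfl⟩, hb⟩
      exact ⟨hb, expBinomial_expShift_mem σK hσ (hGp g (Finset.mem_union_left _ hg)) e⟩
    · exact ⟨fun i j _ => rfl, by simp [expBinomial]⟩
    · rintro x y - - ⟨hx, hxp⟩ ⟨hy, hyp⟩
      refine ⟨fun i j hij => by rw [Finsupp.add_apply, hx i j hij, hy i j hij, add_zero],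
        expBinomial_add_mem hp hxp hyp fun ⟨i, j⟩ hv => ?_⟩
      exact ⟨hx i j ((hX i j).1 hv).2, hy i j ((hX i j).1 hv).2⟩
    · rintro x - ⟨hx, hxp⟩
      exact ⟨fun i j hij => by rw [Finsupp.neg_apply, hx i j hij, neg_zero],
        by rw [expBinomial_neg]; exact p.neg_mem hxp⟩
  · have hmem : ∀ h ∈ Λ, h.support = f.support → ¬ InBox a h →
        MvPolynomial.monomial (posExp (-h)) (1 : K) ∈ p := by
      intro h hh hsupp hb
      have hout := hesc h hh
      simp only [Escapes, not_and, not_not] at hout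
      by_contra hcon
      refine hb (hout fun i j hij hne => ?_)
      have hi : i ∈ Z := by
        by_contra hi
        have h1 : (i, j) ∈ f.support := hsupp ▸ Finsupp.mem_support_iff.2 hne
        have h2 : j ≤ f.support.sup Prod.snd := Finset.le_sup (f := Prod.snd) h1
        have h3 := ha i hi
        omega
      refine ⟨?_, hi⟩
      by_contra hneg
      refine hcon ((monomial_mem_iff_of_isPrime hp _).2 ⟨(i, j), ?_, (hX i j).2 ⟨hi, hij⟩⟩)
      rw [posExp_apply, Finsupp.neg_apply]
      omega
    refine p.sub_mem ?_ (hmem f hf rfl hbox)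
    have := hmem (-f) (Λ.neg_mem hf) (Finsupp.support_neg f) fun h => hbox fun i j hij => by
      simpa using h i j hij
    rwa [neg_neg] at this

end LatticeIdeal

/-- If the lattice σ-ideal `I_L` is well-mixed, then it is finitely generated as a
radical well-mixed σ-ideal. -/
theorem stmt1 {K : Type*} [Field K] [CharZero K] {n : ℕ} (σK : K →+* K)
    (L : Submodule (Polynomial ℤ) (Fin n → Polynomial ℤ))
    (hwm : IsWellMixed (shift σK) (latticeIdeal σK L)) :
    ∃ G : Set (DPoly K n), G.Finite ∧
      G ⊆ ((latticeIdeal σK L : Ideal (DPoly K n)) : Set (DPoly K n)) ∧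
      latticeIdeal σK L = rwmClosure (shift σK) G := by
  obtain ⟨G, hG, hGp⟩ := exists_finset_forall_isPrime σK (expLattice L) (shiftStable_expLattice L)
  rw [latticeIdeal_eq_expLatticeIdeal] at hwm ⊢
  have hsub : expBinomial K '' (G : Set (ExpVec n)) ⊆ expLatticeIdeal K (expLattice L) :=
    (Set.image_mono hG).trans Ideal.subset_span
  refine ⟨_, G.finite_toSet.image _, hsub, le_antisymm (le_sInf ?_) (sInf_le ⟨hsub, ?_, hwm, ?_⟩)⟩
  · rintro P ⟨hGP, -, hPwm, hPrad⟩
    rw [← hPrad.radical, ← Ideal.sInf_minimalPrimes]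
    refine le_sInf fun p hp => Ideal.span_le.2 ?_
    rintro _ ⟨f, hf, rfl⟩
    exact hGp p hp.isPrime (isSigmaIdeal_of_mem_minimalPrimes hPwm hPrad hp)
      (fun g hg => hp.le (hGP ⟨g, hg, rfl⟩)) f hf
  · exact isSigmaIdeal_expLatticeIdeal σK (shiftStable_expLattice L)
  · exact isRadical_expLatticeIdeal _
end
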